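/- arXiv:1705.09221 — 7 statements merged into one kernel-verified Lean document; each statement's English description precedes it below -/
import Mathlib

section
/- Let n be a positive integer, let x_1, …, x_n be nonzero complex numbers that are pairwise distinct, and let t, y_1, …, y_n be complex numbers with t·x_k ≠ 1 for all k. Then the following partial fraction decomposition holds: ∏_{i=1}^n (1 − t·x_i·y_i)/(1 − t·x_i) = y_1·y_2⋯y_n + ∑_{k=1}^n [ ∏_{i=1}^n (1 − y_i·x_i/x_k) ] / [ (1 − t·x_k) · ∏_{i=1, i≠k}^n (1 − x_i/x_k) ]. -/
open Finset

open Polynomial in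
/-- Two products of linear factors whose leading coefficients are matched by a scalar differ by a
polynomial of smaller degree. -/
lemma degree_prod_sub_C_mul_prod_lt {R ι : Type*} [CommRing R] (s : Finset ι) (x y : ι → R) :
    (∏ i ∈ s, (1 - C (x i * y i) * X) - C (∏ i ∈ s, y i) * ∏ i ∈ s, (1 - C (x i) * X)).degree
      < #s := by
  have hlin (a : R) : (1 - C a * X).natDegree ≤ 1 := by compute_degree
  have hdeg (a : ι → R) : (∏ i ∈ s, (1 - C (a i) * X)).natDegree ≤ #s := by
    simpa using (natDegree_prod_le s _).trans (sum_le_sum fun i _ => hlin (a i))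
  have hcoeff (a : ι → R) : (∏ i ∈ s, (1 - C (a i) * X)).coeff #s = ∏ i ∈ s, -a i := by
    simpa [coeff_one] using coeff_prod_of_natDegree_le s (fun i => 1 - C (a i) * X) 1
      (fun i _ => hlin (a i))
  rw [degree_lt_iff_coeff_zero]
  intro m hm
  rcases hm.eq_or_lt with rfl | hm
  · rw [coeff_sub, coeff_C_mul, hcoeff, hcoeff, ← prod_mul_distrib, sub_eq_zero]
    exact prod_congr rfl fun i _ => by ring
  · rw [coeff_sub, coeff_C_mul, coeff_eq_zero_of_natDegree_lt ((hdeg _).trans_lt hm),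
      coeff_eq_zero_of_natDegree_lt ((hdeg _).trans_lt hm), mul_zero, sub_zero]

/-- Partial fraction decomposition (Milne):
`∏ (1 - t x_i y_i)/(1 - t x_i) = y_1 ⋯ y_n + ∑_k ∏ (1 - y_i x_i/x_k) / ((1 - t x_k) ∏_{i≠k} (1 - x_i/x_k))`. -/
theorem stmt_0 (n : ℕ) (hn : 0 < n) (x : Fin n → ℂ) (hx0 : ∀ i, x i ≠ 0)
    (hxd : ∀ i j : Fin n, i ≠ j → x i ≠ x j) (t : ℂ) (y : Fin n → ℂ)
    (ht : ∀ i, t * x i ≠ 1) :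
    (∏ i, (1 - t * x i * y i) / (1 - t * x i)) =
      (∏ i, y i) +
        ∑ k : Fin n, (∏ i, (1 - y i * x i / x k)) /
          ((1 - t * x k) * ∏ i ∈ Finset.univ.erase k, (1 - x i / x k)) := by
  have ht' (i : Fin n) : 1 - t * x i ≠ 0 := sub_ne_zero.2 (ht i).symm
  have hinj : Set.InjOn (fun i => (x i)⁻¹) (univ : Finset (Fin n)) := fun i _ j _ h =>
    by_contra fun hij => hxd i j hij (inv_injective h)
  have h := congrArg (Polynomial.eval t)
    (Lagrange.eq_interpolate hinj (degree_prod_sub_C_mul_prod_lt univ x y))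
  have hnode (k : Fin n) : ∏ i, (1 - x i * (x k)⁻¹) = 0 :=
    prod_eq_zero (mem_univ k) (by rw [mul_inv_cancel₀ (hx0 k), sub_self])
  have hbasis (k : Fin n) : (Lagrange.basis univ (fun i => (x i)⁻¹) k).eval t =
      (∏ i ∈ univ.erase k, (1 - t * x i)) / ∏ i ∈ univ.erase k, (1 - x i / x k) := by
    rw [Lagrange.basis, Polynomial.eval_prod, ← prod_div_distrib]
    refine prod_congr rfl fun i hi => ?_
    have hik := hxd i k (ne_of_mem_erase hi)
    have h1 : x k - x i ≠ 0 := sub_ne_zero.2 hik.symm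
    have h2 : x i - x k ≠ 0 := sub_ne_zero.2 hik
    have hi0 := hx0 i
    have hk0 := hx0 k
    have h3 : (x k)⁻¹ - (x i)⁻¹ = (x i - x k) / (x i * x k) := by field_simp
    have h4 : 1 - x i / x k = (x k - x i) / x k := by field_simp
    simp only [Lagrange.basisDivisor, Polynomial.eval_mul, Polynomial.eval_C, Polynomial.eval_sub,
      Polynomial.eval_X]
    rw [h3, h4]
    field_simp
    ring
  simp only [Lagrange.interpolate_apply, Polynomial.eval_sub, Polynomial.eval_mul,
    Polynomial.eval_prod, Polynomial.eval_finsetSum, Polynomial.eval_C, Polynomial.eval_X,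
    Polynomial.eval_one, hnode, hbasis, mul_zero, sub_zero] at h
  rw [prod_div_distrib, div_eq_iff (prod_ne_zero_iff.2 fun i _ => ht' i), add_mul, sum_mul,
    ← sub_eq_iff_eq_add']
  convert h using 1
  · simp only [mul_comm t, mul_right_comm]
  · refine sum_congr rfl fun k _ => ?_
    rw [← mul_prod_erase univ (fun i => 1 - t * x i) (mem_univ k), mul_comm (1 - t * x k),
      ← div_div, div_mul_eq_mul_div, div_mul_eq_mul_div]
    have hk : 1 - x k * t ≠ 0 := mul_comm t (x k) ▸ ht' k
    have e (i : Fin n) : y i * x i / x k = x i * y i * (x k)⁻¹ := by ring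
    simp only [e]
    field_simp
end

section
/- Let n be a positive integer, q a nonzero complex number, k_1, …, k_n and m_1, …, m_n integers, and x_1, …, x_n nonzero complex numbers such that every factor appearing in a denominator below is nonzero. Then ∏_{1≤i<j≤n} (x_i·q^{k_i} − x_j·q^{k_j})/(x_i·q^{m_i} − x_j·q^{m_j}) · ∏_{i=1}^n ∏_{j=1}^n (q^{m_i−k_j}·x_i/x_j; q)_{k_i−m_i}/(q^{1+m_i−m_j}·x_i/x_j; q)_{k_i−m_i} = (−1)^{|k|−|m|} · q^{−(|k|−|m|+1)(|k|−|m|)/2}, where |k| = k_1 + ⋯ + k_n and |m| = m_1 + ⋯ + m_n. -/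
open Finset

/-- The q-shifted factorial `(a;q)_k` for an integer index `k`. -/
noncomputable def qPochInt (q a : ℂ) (k : ℤ) : ℂ :=
  if 0 ≤ k then ∏ i ∈ Finset.range k.toNat, (1 - a * q ^ i)
  else (∏ i ∈ Finset.range (-k).toNat, (1 - a * q ^ (-(i : ℤ) - 1)))⁻¹

/-- A double product splits into its diagonal and the products over pairs `i < j`. -/
@[to_additive]
theorem prod_prod_eq_diag_mul_pairs {n : ℕ} {M : Type*} [CommMonoid M] (f : Fin n → Fin n → M) :
    ∏ i, ∏ j, f i j = (∏ i, f i i) * ∏ i, ∏ j, if i < j then f i j * f j i else 1 := by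
  have h₁ : ∀ i j, f i j = (if i = j then f i j else 1) *
      ((if i < j then f i j else 1) * (if j < i then f i j else 1)) := by
    intro i j
    rcases lt_trichotomy i j with h | h | h
    · simp [h, h.ne, h.not_gt]
    · simp [h]
    · simp [h, h.ne', h.not_gt]
  have h₂ : ∀ i j, (if i < j then f i j * f j i else 1) =
      (if i < j then f i j else 1) * (if i < j then f j i else 1) := by
    intro i j
    split_ifs <;> simp
  have h₃ : ∏ i, ∏ j, (if j < i then f i j else 1) = ∏ i, ∏ j, (if i < j then f j i else 1) :=
    Finset.prod_comm
  simp only [h₂, Finset.prod_mul_distrib]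
  rw [Finset.prod_congr rfl fun i _ => Finset.prod_congr rfl fun j _ => h₁ i j]
  simp only [Finset.prod_mul_distrib]
  rw [h₃]
  simp

theorem qPochInt_natCast (q a : ℂ) (N : ℕ) :
    qPochInt q a (N : ℤ) = ∏ s ∈ range N, (1 - a * q ^ s) := by
  simp [qPochInt]

/-- `(q;q)_k` has a vanishing denominator for negative `k`. -/
theorem qPochInt_self_of_neg {q : ℂ} (hq : q ≠ 0) {k : ℤ} (hk : k < 0) : qPochInt q q k = 0 := by
  rw [qPochInt, if_neg (not_le.mpr hk), inv_eq_zero]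
  refine Finset.prod_eq_zero (i := 0) (by simp; omega) ?_
  simp [hq]

/-- The two-variable identity behind the off-diagonal factors, in division-free form. -/
theorem pair_prod_identity {q z : ℂ} (hq : q ≠ 0) (hz : z ≠ 0) (a b : ℕ) :
    (z * q ^ a - q ^ b) * (∏ s ∈ range a, (1 - q ^ (-(b : ℤ)) * z * q ^ s)) *
        ∏ s ∈ range b, (1 - q ^ (-(a : ℤ)) * z⁻¹ * q ^ s) =
      q ^ (-((a : ℤ) * b)) * (z - 1) * (∏ s ∈ range a, (1 - q * z * q ^ s)) *
        ∏ s ∈ range b, (1 - q * z⁻¹ * q ^ s) := by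
  induction a with
  | zero =>
    have h := Finset.prod_range_succ (fun s => 1 - z⁻¹ * q ^ s) b
    rw [Finset.prod_range_succ'] at h
    have h₁ : ∏ s ∈ range b, (1 - z⁻¹ * q ^ (s + 1)) = ∏ s ∈ range b, (1 - q * z⁻¹ * q ^ s) :=
      Finset.prod_congr rfl fun s _ => by ring
    rw [h₁] at h
    simp only [Nat.cast_zero, neg_zero, zpow_zero, one_mul, range_zero, prod_empty, mul_one,
      pow_zero, zero_mul] at h ⊢
    have h₂ : z - q ^ b = z * (1 - z⁻¹ * q ^ b) := by field_simp
    have h₃ : z - 1 = z * (1 - z⁻¹) := by field_simp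
    rw [h₂, h₃]
    linear_combination -z * h
  | succ a ih =>
    have h := Finset.prod_range_succ (fun s => 1 - q ^ (-((a + 1 : ℕ) : ℤ)) * z⁻¹ * q ^ s) b
    rw [Finset.prod_range_succ'] at h
    have h₁ : ∏ s ∈ range b, (1 - q ^ (-((a + 1 : ℕ) : ℤ)) * z⁻¹ * q ^ (s + 1)) =
        ∏ s ∈ range b, (1 - q ^ (-(a : ℤ)) * z⁻¹ * q ^ s) := by
      refine Finset.prod_congr rfl fun s _ => ?_
      simp only [zpow_neg, zpow_natCast]
      field_simp
      ring
    rw [h₁] at h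
    have h₂ : z * q ^ (a + 1) - q ^ b =
        z * q ^ (a + 1) * (1 - q ^ (-((a + 1 : ℕ) : ℤ)) * z⁻¹ * q ^ b) := by
      simp only [zpow_neg, zpow_natCast]
      field_simp
    have h₃ : z * q ^ (a + 1) * (1 - q ^ (-((a + 1 : ℕ) : ℤ)) * z⁻¹ * q ^ 0) =
        z * q ^ (a + 1) - 1 := by
      simp only [zpow_neg, zpow_natCast]
      field_simp
    have h₄ : 1 - q ^ (-(b : ℤ)) * z * q ^ a = -(q ^ (-(b : ℤ))) * (z * q ^ a - q ^ b) := by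
      simp only [zpow_neg, zpow_natCast]
      field_simp
      ring
    have h₅ : q ^ (-(((a + 1 : ℕ) : ℤ) * b)) = q ^ (-((a : ℤ) * b)) * q ^ (-(b : ℤ)) := by
      rw [← zpow_add₀ hq]
      congr 1
      push_cast
      ring
    rw [Finset.prod_range_succ, Finset.prod_range_succ, h₄, h₅]
    generalize ∏ s ∈ range b, (1 - q ^ (-((a + 1 : ℕ) : ℤ)) * z⁻¹ * q ^ s) = P at *
    generalize ∏ s ∈ range b, (1 - q ^ (-(a : ℤ)) * z⁻¹ * q ^ s) = P' at *
    generalize ∏ s ∈ range a, (1 - q ^ (-(b : ℤ)) * z * q ^ s) = Q at *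
    generalize ∏ s ∈ range b, (1 - q * z⁻¹ * q ^ s) = R at *
    generalize ∏ s ∈ range a, (1 - q * z * q ^ s) = S at *
    have h₆ : (z * q ^ (a + 1) - q ^ b) * P = (z * q ^ (a + 1) - 1) * P' := by
      rw [h₂, ← h₃]
      linear_combination -(z * q ^ (a + 1)) * h
    linear_combination (-(q ^ (-(b : ℤ))) * (z * q ^ a - q ^ b) * Q) * h₆ +
      (1 - z * q ^ (a + 1)) * q ^ (-(b : ℤ)) * ih

theorem diag_prod_identity {q : ℂ} (hq : q ≠ 0) (a : ℕ) :
    ∏ s ∈ range a, (1 - q ^ (-(a : ℤ)) * q ^ s) =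
      (-1) ^ a * q ^ (-((a : ℤ) * (a + 1) / 2)) * ∏ s ∈ range a, (1 - q * q ^ s) := by
  induction a with
  | zero => simp
  | succ a ih =>
    have h₁ : ∏ s ∈ range a, (1 - q ^ (-((a + 1 : ℕ) : ℤ)) * q ^ (s + 1)) =
        ∏ s ∈ range a, (1 - q ^ (-(a : ℤ)) * q ^ s) := by
      refine Finset.prod_congr rfl fun s _ => ?_
      simp only [zpow_neg, zpow_natCast]
      field_simp
      ring
    have h₂ : q ^ (-(((a + 1 : ℕ) : ℤ) * ((a + 1 : ℕ) + 1) / 2)) =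
        q ^ (-((a : ℤ) * (a + 1) / 2)) * q ^ (-((a + 1 : ℕ) : ℤ)) := by
      rw [← zpow_add₀ hq]
      congr 1
      have : ((a + 1 : ℕ) : ℤ) * ((a + 1 : ℕ) + 1) = (a : ℤ) * (a + 1) + (a + 1) * 2 := by
        push_cast
        ring
      rw [this, Int.add_mul_ediv_right _ _ two_ne_zero]
      push_cast
      ring
    have h₃ : 1 - q ^ (-((a + 1 : ℕ) : ℤ)) * q ^ 0 =
        -(q ^ (-((a + 1 : ℕ) : ℤ))) * (1 - q * q ^ a) := by
      simp only [zpow_neg, zpow_natCast]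
      field_simp
      ring
    rw [Finset.prod_range_succ', Finset.prod_range_succ, h₁, h₂, h₃, ih]
    ring

theorem sum_triangular {n : ℕ} (N : Fin n → ℤ) :
    (∑ i, N i) * (∑ i, N i + 1) / 2 =
      ∑ i, N i * (N i + 1) / 2 + ∑ i, ∑ j, if i < j then N i * N j else 0 := by
  have h := sum_sum_eq_diag_add_pairs fun i j => N i * N j
  rw [← Finset.sum_mul_sum] at h
  have h₁ : ∑ i, N i * (N i + 1) = 2 * ∑ i, N i * (N i + 1) / 2 := by
    rw [Finset.mul_sum]
    exact Finset.sum_congr rfl fun i _ =>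
      (Int.mul_ediv_cancel' (Int.even_mul_succ_self (N i)).two_dvd).symm
  have h₂ : (∑ i, ∑ j, if i < j then N i * N j + N j * N i else 0) =
      2 * ∑ i, ∑ j, if i < j then N i * N j else 0 := by
    simp only [Finset.mul_sum, mul_ite, mul_zero]
    exact Finset.sum_congr rfl fun i _ => Finset.sum_congr rfl fun j _ =>
      if_congr Iff.rfl (by ring) rfl
  simp only [mul_add, mul_one, Finset.sum_add_distrib] at h₁
  refine Int.ediv_eq_of_eq_mul_right two_ne_zero ?_
  simp only [mul_add, mul_one]
  rw [← h₁, ← h₂]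
  linear_combination h

theorem zpow_sum₀ {ι : Type*} (s : Finset ι) {q : ℂ} (hq : q ≠ 0) (f : ι → ℤ) :
    q ^ (∑ i ∈ s, f i) = ∏ i ∈ s, q ^ f i := by
  classical
  induction s using Finset.induction_on with
  | empty => simp
  | insert a s ha ih => rw [Finset.sum_insert ha, Finset.prod_insert ha, zpow_add₀ hq, ih]

/-- Milne's product-simplification lemma. -/
theorem stmt_1 (n : ℕ) (hn : 0 < n) (q : ℂ) (hq : q ≠ 0)
    (k m : Fin n → ℤ) (x : Fin n → ℂ) (hx : ∀ i, x i ≠ 0)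
    (hxm : ∀ i j : Fin n, i < j → x i * q ^ m i ≠ x j * q ^ m j)
    (hden : ∀ i j : Fin n,
      qPochInt q (q ^ (1 + m i - m j) * x i / x j) (k i - m i) ≠ 0)
    (hnum : ∀ i j : Fin n, k i - m i < 0 →
      qPochInt q (q ^ (m i - k j) * x i / x j) (k i - m i) ≠ 0) :
    (∏ i : Fin n, ∏ j : Fin n, if i < j then
        (x i * q ^ k i - x j * q ^ k j) / (x i * q ^ m i - x j * q ^ m j) else 1) *
      (∏ i : Fin n, ∏ j : Fin n,
        qPochInt q (q ^ (m i - k j) * x i / x j) (k i - m i) /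
          qPochInt q (q ^ (1 + m i - m j) * x i / x j) (k i - m i)) =
      (-1) ^ ((∑ i, k i) - ∑ i, m i) *
        q ^ (-(((∑ i, k i) - ∑ i, m i) * (((∑ i, k i) - ∑ i, m i) + 1) / 2)) := by
  have hself : ∀ i, q ^ (1 + m i - m i) * x i / x i = q := fun i => by
    rw [mul_div_assoc, div_self (hx i)]
    simp
  have hkm : ∀ i, 0 ≤ k i - m i := by
    intro i
    by_contra! h
    have := hden i i
    rw [hself] at this
    exact this (qPochInt_self_of_neg hq h)
  choose N hN using fun i => Int.eq_ofNat_of_zero_le (hkm i)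
  obtain rfl : k = fun i => m i + N i := funext fun i => by linarith [hN i]
  have hxy : ∀ i, x i * q ^ m i ≠ 0 := fun i => mul_ne_zero (hx i) (zpow_ne_zero _ hq)
  have hD : ∀ i j, q ^ (1 + m i - m j) * x i / x j =
      q * (x i * q ^ m i / (x j * q ^ m j)) := fun i j => by
    rw [zpow_sub₀ hq, zpow_add₀ hq, zpow_one]
    have := hx j
    field_simp
  have hP : ∀ i j, q ^ (m i - (m j + N j)) * x i / x j =
      q ^ (-(N j : ℤ)) * (x i * q ^ m i / (x j * q ^ m j)) := fun i j => by
    rw [zpow_sub₀ hq, zpow_add₀ hq, zpow_neg]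
    have := hx j
    field_simp
  have hY : ∀ i, x i * q ^ (m i + (N i : ℤ)) = x i * q ^ m i * q ^ N i := fun i => by
    rw [zpow_add₀ hq, zpow_natCast, mul_assoc]
  have hsum : ∑ i, (m i + (N i : ℤ)) - ∑ i, m i = ∑ i, (N i : ℤ) := by
    rw [Finset.sum_add_distrib, add_sub_cancel_left]
  clear hnum
  simp only [hD, hP, hY, add_sub_cancel_left, qPochInt_natCast] at hden ⊢
  rw [hsum, sum_triangular, neg_add, zpow_add₀ hq, zpow_sum₀ _ (by norm_num),
    prod_prod_eq_diag_mul_pairs fun i j => (_ / _ : ℂ), mul_left_comm,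
    ← mul_assoc (∏ i, (-1 : ℂ) ^ (N i : ℤ))]
  congr 1
  · rw [← Finset.sum_neg_distrib, zpow_sum₀ _ hq, ← Finset.prod_mul_distrib]
    refine Finset.prod_congr rfl fun i _ => ?_
    have h := hden i i
    simp only [div_self (hxy i), mul_one] at h ⊢
    rw [diag_prod_identity hq, mul_div_assoc, div_self h, mul_one, zpow_natCast]
  · simp only [← Finset.sum_neg_distrib, zpow_sum₀ _ hq, ← Finset.prod_mul_distrib]
    refine Finset.prod_congr rfl fun i _ => Finset.prod_congr rfl fun j _ => ?_
    split_ifs with hij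
    · have h₁ := hden i j
      have h₂ := hden j i
      have hi := hxy i
      have hj := hxy j
      have hne := hxm i j hij
      generalize x i * q ^ m i = y at *
      generalize x j * q ^ m j = w at *
      have hid := pair_prod_identity hq (div_ne_zero hi hj) (N i) (N j)
      rw [inv_div] at hid
      have hyw : y - w ≠ 0 := sub_ne_zero.mpr hne
      rw [div_mul_div_comm, div_mul_div_comm, div_eq_iff (mul_ne_zero hyw (mul_ne_zero h₁ h₂))]
      have h₃ : y * q ^ N i - w * q ^ N j = w * (y / w * q ^ N i - q ^ N j) := by field_simp
      have h₄ : y - w = w * (y / w - 1) := by field_simp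
      rw [h₃, h₄]
      linear_combination w * hid
    · simp
end

section
/- Let n be a positive integer, q a nonzero complex number, N_1, …, N_n nonnegative integers, k_1, …, k_n integers with 0 ≤ k_i ≤ N_i, and x_1, …, x_n nonzero complex numbers such that all factors in the denominators below are nonzero. Then the A_n q-binomial coefficient ∏_{i=1}^n ∏_{j=1}^n (q·x_i/x_j; q)_{N_i} / [ (q·x_i/x_j; q)_{k_i} · (q^{1+k_i−k_j}·x_i/x_j; q)_{N_i−k_i} ] remains unchanged after performing the simultaneous substitutions k_i ↦ N_i − k_i and x_i ↦ q^{−N_i}/x_i for i = 1, …, n. -/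
open Finset

/-- The q-shifted factorial `(a;q)_k`. -/
noncomputable def qPoch (q a : ℂ) (k : ℕ) : ℂ := ∏ i ∈ Finset.range k, (1 - a * q ^ i)

theorem qPoch_add (q a : ℂ) (m n : ℕ) :
    qPoch q a (m + n) = qPoch q a m * qPoch q (a * q ^ m) n := by
  simp only [qPoch, Finset.prod_range_add, pow_add, mul_assoc]

/-- Two ways of splitting `(b;q)_{k+m}` give equal quotients of q-shifted factorials. -/
theorem qPoch_div_eq_qPoch_div {q a b c : ℂ} {h k l m : ℕ}
    (hab : a * q ^ h = b * q ^ k) (hbc : b * q ^ m = c * q ^ l)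
    (ha : qPoch q a h ≠ 0) (hbm : qPoch q b m ≠ 0)
    (hc : qPoch q c l ≠ 0) (hbk : qPoch q b k ≠ 0) :
    qPoch q a (h + m) / (qPoch q a h * qPoch q b m) =
      qPoch q c (l + k) / (qPoch q c l * qPoch q b k) := by
  have key : qPoch q b k * qPoch q (b * q ^ k) m = qPoch q b m * qPoch q (b * q ^ m) k := by
    rw [← qPoch_add, ← qPoch_add, add_comm]
  rw [qPoch_add, qPoch_add q c, hab, ← hbc, mul_div_mul_left _ _ ha, mul_div_mul_left _ _ hc,
    div_eq_div_iff hbm hbk]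
  linear_combination key

/-- Invariance of the `A_n` q-binomial coefficient under the simultaneous substitutions
`k_i ↦ N_i - k_i` and `x_i ↦ q^{-N_i}/x_i`. -/
theorem stmt_2 (n : ℕ) (hn : 0 < n) (q : ℂ) (hq : q ≠ 0)
    (N k : Fin n → ℕ) (hk : ∀ i, k i ≤ N i)
    (x : Fin n → ℂ) (hx : ∀ i, x i ≠ 0)
    (hd1 : ∀ i j : Fin n, qPoch q (q * x i / x j) (k i) ≠ 0)
    (hd2 : ∀ i j : Fin n,
      qPoch q (q ^ (1 + (k i : ℤ) - (k j : ℤ)) * x i / x j) (N i - k i) ≠ 0)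
    (hd3 : ∀ i j : Fin n,
      qPoch q (q * (q ^ (-(N i : ℤ)) / x i) / (q ^ (-(N j : ℤ)) / x j)) (N i - k i) ≠ 0)
    (hd4 : ∀ i j : Fin n,
      qPoch q (q ^ (1 + ((N i - k i : ℕ) : ℤ) - ((N j - k j : ℕ) : ℤ)) *
        (q ^ (-(N i : ℤ)) / x i) / (q ^ (-(N j : ℤ)) / x j)) (N i - (N i - k i)) ≠ 0) :
    (∏ i, ∏ j, qPoch q (q * x i / x j) (N i) /
        (qPoch q (q * x i / x j) (k i) *
          qPoch q (q ^ (1 + (k i : ℤ) - (k j : ℤ)) * x i / x j) (N i - k i))) =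
    (∏ i, ∏ j, qPoch q (q * (q ^ (-(N i : ℤ)) / x i) / (q ^ (-(N j : ℤ)) / x j)) (N i) /
        (qPoch q (q * (q ^ (-(N i : ℤ)) / x i) / (q ^ (-(N j : ℤ)) / x j)) (N i - k i) *
          qPoch q (q ^ (1 + ((N i - k i : ℕ) : ℤ) - ((N j - k j : ℕ) : ℤ)) *
            (q ^ (-(N i : ℤ)) / x i) / (q ^ (-(N j : ℤ)) / x j)) (N i - (N i - k i)))) := by
  have base (i j : Fin n) : q * (q ^ (-(N j : ℤ)) / x j) / (q ^ (-(N i : ℤ)) / x i) =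
      q ^ (1 + (N i : ℤ) - (N j : ℤ)) * x i / x j := by
    have := hx i
    have := hx j
    rw [zpow_sub₀ hq, zpow_add₀ hq, zpow_one, zpow_neg, zpow_neg]
    field_simp
  have shifted (i j : Fin n) :
      q ^ (1 + ((N j - k j : ℕ) : ℤ) - ((N i - k i : ℕ) : ℤ)) *
        (q ^ (-(N j : ℤ)) / x j) / (q ^ (-(N i : ℤ)) / x i) =
      q ^ (1 + (k i : ℤ) - (k j : ℤ)) * x i / x j := by
    have := hx i
    have := hx j
    have hexp : q ^ (1 + ((N j - k j : ℕ) : ℤ) - ((N i - k i : ℕ) : ℤ)) =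
        q ^ (1 + (k i : ℤ) - (k j : ℤ)) * q ^ (N j : ℤ) / q ^ (N i : ℤ) := by
      rw [← zpow_add₀ hq, ← zpow_sub₀ hq, Nat.cast_sub (hk i), Nat.cast_sub (hk j)]
      congr 1
      ring
    rw [hexp, zpow_neg, zpow_neg]
    field_simp
  conv_rhs => rw [Finset.prod_comm]
  refine Finset.prod_congr rfl fun i _ => Finset.prod_congr rfl fun j _ => ?_
  have hc := hd3 j i
  have hb := hd4 j i
  rw [base i j] at hc ⊢
  rw [shifted i j, Nat.sub_sub_self (hk j)] at hb
  rw [shifted i j, Nat.sub_sub_self (hk j)]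
  have hab : q * x i / x j * q ^ k i =
      q ^ (1 + (k i : ℤ) - (k j : ℤ)) * x i / x j * q ^ k j := by
    rw [zpow_sub₀ hq, zpow_add₀ hq, zpow_one, zpow_natCast, zpow_natCast]
    field_simp
  have hbc : q ^ (1 + (k i : ℤ) - (k j : ℤ)) * x i / x j * q ^ (N i - k i) =
      q ^ (1 + (N i : ℤ) - (N j : ℤ)) * x i / x j * q ^ (N j - k j) := by
    have hexp : q ^ (1 + (k i : ℤ) - (k j : ℤ)) * q ^ (N i - k i) =
        q ^ (1 + (N i : ℤ) - (N j : ℤ)) * q ^ (N j - k j) := by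
      rw [← zpow_natCast q (N i - k i), ← zpow_natCast q (N j - k j), ← zpow_add₀ hq,
        ← zpow_add₀ hq, Nat.cast_sub (hk i), Nat.cast_sub (hk j)]
      congr 1
      ring
    linear_combination x i / x j * hexp
  simpa only [Nat.add_sub_cancel' (hk i), Nat.sub_add_cancel (hk j)] using
    qPoch_div_eq_qPoch_div hab hbc (hd1 i j) (hd2 i j) hc hb
end

section
/- Fundamental theorem of A_n series (Milne): Let n be a positive integer, N a nonnegative integer, q a nonzero complex number that is not a root of unity, a_1, …, a_n complex numbers, and x_1, …, x_n nonzero complex numbers such that x_i/x_j is not an integer power of q for i ≠ j. Then ∑_{k_1,…,k_n ≥ 0, k_1+⋯+k_n = N} ∏_{1≤i<j≤n} (x_i·q^{k_i} − x_j·q^{k_j})/(x_i − x_j) · ∏_{i=1}^n ∏_{j=1}^n (a_j·x_i/x_j; q)_{k_i}/(q·x_i/x_j; q)_{k_i} = (a_1·a_2⋯a_n; q)_N / (q; q)_N. -/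
open Finset

open Polynomial in
/-- The partial fraction expansion behind the case `N = 1` of the `A_n` summation. -/
theorem sum_prod_one_sub_div_prod_erase {ι F : Type*} [Fintype ι] [DecidableEq ι] [Field F]
    (b y : ι → F) (hy : ∀ i, y i ≠ 0) (hinj : Function.Injective y) :
    ∑ i, (∏ j, (1 - b j * (y i / y j))) / ∏ j ∈ univ.erase i, (1 - y i / y j) =
      1 - ∏ j, b j := by
  have hdeg (c : F) : (1 - C c * X : F[X]).natDegree ≤ 1 := by compute_degree
  have hprod (c : ι → F) : (∏ j, (1 - C (c j) * X) : F[X]).natDegree ≤ Fintype.card ι := by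
    refine (natDegree_prod_le _ _).trans ((sum_le_card_nsmul _ _ 1 fun j _ => hdeg _).trans ?_)
    simp
  have hcoeff (c : ι → F) :
      (∏ j, (1 - C (c j) * X) : F[X]).coeff (Fintype.card ι) = ∏ j, -c j := by
    have := coeff_prod_of_natDegree_le (s := univ) (fun j => (1 - C (c j) * X : F[X])) 1
      (fun j _ => hdeg _)
    simpa [coeff_one] using this
  set Q : F[X] := ∏ j, (1 - C (b j / y j) * X) - C (∏ j, b j) * ∏ j, (1 - C (1 / y j) * X)
    with hQ
  have hQdeg : Q.degree < #(univ : Finset ι) := by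
    rw [degree_lt_iff_coeff_zero]
    intro m hm
    rcases (show Fintype.card ι ≤ m from hm).eq_or_lt with rfl | hlt
    · rw [hQ, coeff_sub, coeff_C_mul, hcoeff, hcoeff, ← prod_mul_distrib, sub_eq_zero]
      exact prod_congr rfl fun j _ => by ring
    · rw [hQ, coeff_sub, coeff_C_mul, coeff_eq_zero_of_natDegree_lt ((hprod _).trans_lt hlt),
        coeff_eq_zero_of_natDegree_lt ((hprod _).trans_lt hlt)]
      simp
  have hQy (i : ι) : Q.eval (y i) = ∏ j, (1 - b j * (y i / y j)) := by
    have h0 : ∏ j, (1 - 1 / y j * y i) = 0 :=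
      prod_eq_zero (mem_univ i) (by rw [one_div_mul_cancel (hy i), sub_self])
    simp only [hQ, eval_sub, eval_mul, eval_prod, eval_C, eval_X, eval_one, h0, mul_zero, sub_zero]
    exact prod_congr rfl fun j _ => by ring
  have h := congrArg (eval 0) (Lagrange.eq_interpolate (s := univ) hinj.injOn hQdeg)
  have hQ0 : Q.eval 0 = 1 - ∏ j, b j := by simp [hQ, eval_prod]
  rw [← hQ0, h, Lagrange.interpolate_apply, eval_finsetSum]
  refine sum_congr rfl fun i _ => ?_
  rw [eval_mul, eval_C, hQy, div_eq_mul_inv, ← prod_inv_distrib, Lagrange.basis, eval_prod]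
  congr 1
  refine prod_congr rfl fun j hj => ?_
  have hne : y i - y j ≠ 0 := sub_ne_zero.2 fun e => (mem_erase.1 hj).1 (hinj e).symm
  have hne' : y j - y i ≠ 0 := sub_ne_zero.2 fun e => (mem_erase.1 hj).1 (hinj e)
  have := hy j
  rw [Lagrange.basisDivisor, one_sub_div this, inv_div]
  simp only [eval_mul, eval_sub, eval_C, eval_X]
  field_simp
  ring

/-- The factors of a product over unordered pairs that involve a given index. -/
theorem prod_prod_ite_lt_eq_mul_prod_erase {ι M : Type*} [Fintype ι] [LinearOrder ι] [CommMonoid M]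
    (D : ι → ι → M) (hD : ∀ i j, D i j = D j i) (i : ι) :
    ∏ a, ∏ b, (if a < b then D a b else 1) =
      (∏ a ∈ univ.erase i, ∏ b ∈ univ.erase i, if a < b then D a b else 1) *
        ∏ j ∈ univ.erase i, D i j := by
  rw [← mul_prod_erase univ _ (mem_univ i), ← mul_prod_erase univ _ (mem_univ i)]
  have h : ∏ a ∈ univ.erase i, ∏ b, (if a < b then D a b else 1) =
      ∏ a ∈ univ.erase i,
        ((if a < i then D a i else 1) * ∏ b ∈ univ.erase i, if a < b then D a b else 1) :=
    prod_congr rfl fun a _ => (mul_prod_erase univ _ (mem_univ i)).symm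
  rw [h, prod_mul_distrib, if_neg (lt_irrefl i), one_mul, ← mul_assoc, mul_comm, ← prod_mul_distrib]
  congr 1
  refine prod_congr rfl fun j hj => ?_
  rcases lt_or_gt_of_ne (mem_erase.1 hj).1 with hlt | hlt
  · rw [if_neg hlt.not_gt, if_pos hlt, one_mul, hD]
  · rw [if_pos hlt, if_neg hlt.not_gt, mul_one]

/-- The Vandermonde quotient with one variable changed. -/
theorem vandermonde_quotient_update {ι F : Type*} [Fintype ι] [LinearOrder ι] [Field F]
    (x y : ι → F) (hy : ∀ j, y j ≠ 0) (i : ι) (z : F) (hz : ∀ j, j ≠ i → z ≠ y j)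
    (hi : ∀ j, j ≠ i → y i ≠ y j) :
    (∏ a, ∏ b, if a < b then
        (Function.update y i z a - Function.update y i z b) / (x a - x b) else 1) /
        ∏ j ∈ univ.erase i, (1 - z / y j) =
      (∏ a, ∏ b, if a < b then (y a - y b) / (x a - x b) else 1) /
        ∏ j ∈ univ.erase i, (1 - y i / y j) := by
  have hsymm (w : ι → F) (a b : ι) : (w a - w b) / (x a - x b) = (w b - w a) / (x b - x a) := by
    rw [← neg_sub (w b), ← neg_sub (x b), neg_div_neg_eq]
  rw [prod_prod_ite_lt_eq_mul_prod_erase _ (hsymm _) i,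
    prod_prod_ite_lt_eq_mul_prod_erase _ (hsymm _) i, mul_div_assoc, mul_div_assoc,
    ← prod_div_distrib, ← prod_div_distrib]
  congr 1
  · refine prod_congr rfl fun a ha => prod_congr rfl fun b hb => ?_
    rw [Function.update_of_ne (mem_erase.1 ha).1, Function.update_of_ne (mem_erase.1 hb).1]
  · refine prod_congr rfl fun j hj => ?_
    have hj := (mem_erase.1 hj).1
    have h (w : F) (hw : w ≠ y j) :
        (w - y j) / (x i - x j) / (1 - w / y j) = -y j / (x i - x j) := by
      rw [one_sub_div (hy j), div_div_div_eq, ← neg_sub (y j) w, mul_comm (x i - x j),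
        neg_mul, neg_div, mul_div_mul_left _ _ (sub_ne_zero.2 hw.symm), neg_div]
    rw [Function.update_self, Function.update_of_ne hj, h z (hz j hj), h (y i) (hi j hj)]

/-- The summand of Milne's `A_n` series. -/
noncomputable def milneTerm {n : ℕ} (q : ℂ) (a x : Fin n → ℂ) (k : Fin n → ℕ) : ℂ :=
  (∏ i, ∏ j, if i < j then (x i * q ^ k i - x j * q ^ k j) / (x i - x j) else 1) *
    ∏ i, ∏ j, qPoch q (a j * x i / x j) (k i) / qPoch q (q * x i / x j) (k i)

theorem qPoch_succ (q a : ℂ) (k : ℕ) : qPoch q a (k + 1) = qPoch q a k * (1 - a * q ^ k) :=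
  prod_range_succ _ _

section

variable {n : ℕ} {q : ℂ} {x : Fin n → ℂ}

theorem mul_pow_ne_mul_pow (hq : q ≠ 0) (hx : ∀ i, x i ≠ 0)
    (hxq : ∀ i j : Fin n, i ≠ j → ∀ m : ℤ, x i / x j ≠ q ^ m) {i j : Fin n} (hij : i ≠ j)
    (r s : ℕ) : x i * q ^ r ≠ x j * q ^ s := by
  intro h
  apply hxq i j hij ((s : ℤ) - r)
  rw [zpow_sub₀ hq, zpow_natCast, zpow_natCast, div_eq_div_iff (hx j) (pow_ne_zero _ hq), h,
    mul_comm]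

theorem one_sub_mul_div_ne_zero (hq : q ≠ 0) (hqru : ∀ m : ℕ, 0 < m → q ^ m ≠ 1)
    (hx : ∀ i, x i ≠ 0) (hxq : ∀ i j : Fin n, i ≠ j → ∀ m : ℤ, x i / x j ≠ q ^ m)
    (i j : Fin n) (r : ℕ) : 1 - q * x i / x j * q ^ r ≠ 0 := by
  intro h
  have h' : x i * q ^ (r + 1) = x j * q ^ 0 := by
    have := hx j
    field_simp at h
    linear_combination -h
  rcases eq_or_ne i j with rfl | hij
  · exact hqru (r + 1) r.succ_pos (mul_left_cancel₀ (hx i) (by simpa using h'))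
  · exact mul_pow_ne_mul_pow hq hx hxq hij _ _ h'

theorem milneTerm_update_mul (hq : q ≠ 0) (hqru : ∀ m : ℕ, 0 < m → q ^ m ≠ 1)
    (a : Fin n → ℂ) (hx : ∀ i, x i ≠ 0)
    (hxq : ∀ i j : Fin n, i ≠ j → ∀ m : ℤ, x i / x j ≠ q ^ m) (m k : Fin n → ℕ) (i : Fin n)
    (hk : k = Function.update m i (m i + 1)) :
    milneTerm q a x k * ((∏ j, (1 - q ^ k j * (x i * q ^ k i / (x j * q ^ k j)))) /
        ∏ j ∈ univ.erase i, (1 - x i * q ^ k i / (x j * q ^ k j))) =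
      milneTerm q a x m * ((∏ j, (1 - a j * q ^ m j * (x i * q ^ m i / (x j * q ^ m j)))) /
        ∏ j ∈ univ.erase i, (1 - x i * q ^ m i / (x j * q ^ m j))) := by
  have hki : k i = m i + 1 := by simp [hk]
  have hkj {j : Fin n} (hj : j ≠ i) : k j = m j := by simp [hk, hj]
  have hV := vandermonde_quotient_update x (fun j => x j * q ^ m j)
    (fun j => mul_ne_zero (hx j) (pow_ne_zero _ hq)) i (x i * q ^ k i)
    (fun j hj => mul_pow_ne_mul_pow hq hx hxq hj.symm _ _)
    (fun j hj => mul_pow_ne_mul_pow hq hx hxq hj.symm _ _)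
  have hupd : Function.update (fun j => x j * q ^ m j) i (x i * q ^ k i) =
      fun j => x j * q ^ k j := by
    funext j
    rcases eq_or_ne j i with rfl | hj
    · simp
    · simp [hj, hkj hj]
  have hden : ∏ j ∈ univ.erase i, (1 - x i * q ^ k i / (x j * q ^ k j)) =
      ∏ j ∈ univ.erase i, (1 - x i * q ^ k i / (x j * q ^ m j)) :=
    prod_congr rfl fun j hj => by rw [hkj (mem_erase.1 hj).1]
  rw [hupd, ← hden] at hV
  have hP : (∏ c, ∏ j, qPoch q (a j * x c / x j) (k c) / qPoch q (q * x c / x j) (k c)) *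
        ∏ j, (1 - q ^ k j * (x i * q ^ k i / (x j * q ^ k j))) =
      (∏ c, ∏ j, qPoch q (a j * x c / x j) (m c) / qPoch q (q * x c / x j) (m c)) *
        ∏ j, (1 - a j * q ^ m j * (x i * q ^ m i / (x j * q ^ m j))) := by
    have hsplit (f : Fin n → ℂ) := mul_prod_erase univ f (mem_univ i)
    have herase :
        ∏ c ∈ univ.erase i, ∏ j, qPoch q (a j * x c / x j) (k c) / qPoch q (q * x c / x j) (k c) =
          ∏ c ∈ univ.erase i,
            ∏ j, qPoch q (a j * x c / x j) (m c) / qPoch q (q * x c / x j) (m c) :=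
      prod_congr rfl fun c hc => by rw [hkj (mem_erase.1 hc).1]
    rw [← hsplit fun c => ∏ j, qPoch q (a j * x c / x j) (k c) / qPoch q (q * x c / x j) (k c),
      ← hsplit fun c => ∏ j, qPoch q (a j * x c / x j) (m c) / qPoch q (q * x c / x j) (m c),
      herase, mul_right_comm _ (∏ c ∈ univ.erase i, _), mul_right_comm _ (∏ c ∈ univ.erase i, _),
      ← prod_mul_distrib, ← prod_mul_distrib]
    congr 1
    refine prod_congr rfl fun j _ => ?_
    have h1 : q ^ k j * (x i * q ^ k i / (x j * q ^ k j)) = q * x i / x j * q ^ m i := by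
      have := hx j
      rw [hki, pow_succ']
      field_simp
    have h2 : a j * q ^ m j * (x i * q ^ m i / (x j * q ^ m j)) = a j * x i / x j * q ^ m i := by
      have := hx j
      field_simp
    rw [h1, h2, hki, qPoch_succ, qPoch_succ, div_mul_eq_mul_div,
      mul_div_mul_right _ _ (one_sub_mul_div_ne_zero hq hqru hx hxq i j (m i)), mul_div_right_comm]
  simp only [milneTerm]
  rw [mul_div_assoc', mul_assoc, hP, mul_div_right_comm, hV]
  ring

theorem sum_milneTerm_succ (hq : q ≠ 0) (hqru : ∀ m : ℕ, 0 < m → q ^ m ≠ 1)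
    (a : Fin n → ℂ) (hx : ∀ i, x i ≠ 0)
    (hxq : ∀ i j : Fin n, i ≠ j → ∀ m : ℤ, x i / x j ≠ q ^ m) (N : ℕ) :
    (∑ k ∈ piAntidiag univ (N + 1), milneTerm q a x k) * (1 - q ^ (N + 1)) =
      (∑ m ∈ piAntidiag univ N, milneTerm q a x m) * (1 - (∏ j, a j) * q ^ N) := by
  have hpf (b : Fin n → ℂ) (k : Fin n → ℕ) :=
    sum_prod_one_sub_div_prod_erase b (fun j => x j * q ^ k j)
      (fun j => mul_ne_zero (hx j) (pow_ne_zero _ hq))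
      (fun i j h => by_contra fun hij => mul_pow_ne_mul_pow hq hx hxq hij _ _ h)
  have hl : ∀ k ∈ piAntidiag univ (N + 1), milneTerm q a x k * (1 - q ^ (N + 1)) =
      ∑ i, milneTerm q a x k * ((∏ j, (1 - q ^ k j * (x i * q ^ k i / (x j * q ^ k j)))) /
        ∏ j ∈ univ.erase i, (1 - x i * q ^ k i / (x j * q ^ k j))) := by
    intro k hk
    rw [← mul_sum, hpf, prod_pow_eq_pow_sum, (mem_piAntidiag.1 hk).1]
  have hr : ∀ m ∈ piAntidiag univ N, milneTerm q a x m * (1 - (∏ j, a j) * q ^ N) =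
      ∑ i, milneTerm q a x m * ((∏ j, (1 - a j * q ^ m j * (x i * q ^ m i / (x j * q ^ m j)))) /
        ∏ j ∈ univ.erase i, (1 - x i * q ^ m i / (x j * q ^ m j))) := by
    intro m hm
    rw [← mul_sum, hpf, prod_mul_distrib, prod_pow_eq_pow_sum, (mem_piAntidiag.1 hm).1]
  rw [sum_mul, sum_mul, sum_congr rfl hl, sum_congr rfl hr, sum_comm, sum_comm (s := piAntidiag _ N)]
  refine sum_congr rfl fun i _ => Eq.symm ?_
  refine sum_of_injOn (fun m => Function.update m i (m i + 1)) ?_ ?_ ?_ ?_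
  · intro m _ m' _ h
    funext j
    have := congrFun h j
    rcases eq_or_ne j i with rfl | hj
    · simpa using this
    · simpa [hj] using this
  · intro m hm
    have hm := (mem_piAntidiag.1 hm).1
    rw [mem_coe, mem_piAntidiag]
    refine ⟨?_, by simp⟩
    rw [← add_sum_erase univ _ (mem_univ i)] at hm
    rw [sum_update_of_mem (mem_univ i), ← erase_eq]
    lia
  · intro k hk hk'
    rcases Nat.eq_zero_or_pos (k i) with h0 | hpos
    · have : ∏ j, (1 - q ^ k j * (x i * q ^ k i / (x j * q ^ k j))) = 0 :=
        prod_eq_zero (mem_univ i) (by simp [h0, hx i])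
      rw [this, zero_div, mul_zero]
    · refine absurd ⟨Function.update k i (k i - 1), ?_, ?_⟩ hk'
      · have hk := (mem_piAntidiag.1 hk).1
        rw [mem_coe, mem_piAntidiag]
        refine ⟨?_, by simp⟩
        rw [← add_sum_erase univ _ (mem_univ i)] at hk
        rw [sum_update_of_mem (mem_univ i), ← erase_eq]
        lia
      · simp [Nat.sub_add_cancel hpos]
  · intro m _
    exact (milneTerm_update_mul hq hqru a hx hxq m _ i rfl).symm

theorem sum_milneTerm (hq : q ≠ 0) (hqru : ∀ m : ℕ, 0 < m → q ^ m ≠ 1)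
    (a : Fin n → ℂ) (hx : ∀ i, x i ≠ 0)
    (hxq : ∀ i j : Fin n, i ≠ j → ∀ m : ℤ, x i / x j ≠ q ^ m) (N : ℕ) :
    ∑ k ∈ piAntidiag univ N, milneTerm q a x k = qPoch q (∏ i, a i) N / qPoch q q N := by
  induction N with
  | zero =>
    rw [piAntidiag_zero, sum_singleton]
    have h : ∏ i, ∏ j, (if i < j then (x i - x j) / (x i - x j) else 1) = 1 := by
      refine prod_eq_one fun i _ => prod_eq_one fun j _ => ?_
      split_ifs with hij
      · have := mul_pow_ne_mul_pow hq hx hxq hij.ne 0 0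
        exact div_self (sub_ne_zero.2 (by simpa using this))
      · rfl
    simp [milneTerm, qPoch, h]
  | succ N ih =>
    have hne : 1 - q ^ (N + 1) ≠ 0 := sub_ne_zero.2 (hqru (N + 1) N.succ_pos).symm
    rw [eq_div_of_mul_eq hne (sum_milneTerm_succ hq hqru a hx hxq N), ih, qPoch_succ, qPoch_succ,
      ← pow_succ', div_mul_eq_mul_div, div_div]

end

/-- Milne's fundamental theorem of `A_n` series. -/
theorem stmt_3 (n : ℕ) (hn : 0 < n) (N : ℕ) (q : ℂ) (hq : q ≠ 0)
    (hqru : ∀ m : ℕ, 0 < m → q ^ m ≠ 1)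
    (a : Fin n → ℂ) (x : Fin n → ℂ) (hx : ∀ i, x i ≠ 0)
    (hxq : ∀ i j : Fin n, i ≠ j → ∀ m : ℤ, x i / x j ≠ q ^ m) :
    ∑ k ∈ Finset.filter (fun k : Fin n → ℕ => ∑ i, k i = N)
        (Fintype.piFinset fun _ => Finset.range (N + 1)),
      ((∏ i, ∏ j, if i < j then (x i * q ^ k i - x j * q ^ k j) / (x i - x j) else 1) *
        ∏ i, ∏ j, qPoch q (a j * x i / x j) (k i) / qPoch q (q * x i / x j) (k i)) =
      qPoch q (∏ i, a i) N / qPoch q q N := by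
  have hset : Finset.filter (fun k : Fin n → ℕ => ∑ i, k i = N)
      (Fintype.piFinset fun _ => Finset.range (N + 1)) = piAntidiag univ N := by
    ext k
    simp only [mem_filter, Fintype.mem_piFinset, Finset.mem_range, mem_piAntidiag, mem_univ,
      implies_true, and_true, and_iff_right_iff_imp]
    rintro rfl i
    exact Nat.lt_succ_of_le (single_le_sum (fun _ _ => Nat.zero_le _) (mem_univ i))
  rw [hset]
  exact sum_milneTerm hq hqru a hx hxq N
end

section
/- Holman's A_n Pfaff–Saalschütz summation: Let n be a positive integer, N_1, …, N_n nonnegative integers with |N| = N_1 + ⋯ + N_n, and a, b, c, x_1, …, x_n complex numbers, generic so that x_i − x_j is nonzero for i ≠ j and no shifted-factorial denominator below vanishes. Then ∑_{k_1=0}^{N_1} ⋯ ∑_{k_n=0}^{N_n} [ ∏_{1≤i<j≤n} (x_i + k_i − x_j − k_j)/(x_i − x_j) · ∏_{i,j=1}^n (−N_j + x_i − x_j)_{k_i}/(1 + x_i − x_j)_{k_i} · ∏_{i=1}^n (a + x_i)_{k_i}·(b + x_i)_{k_i} / [ (c + x_i)_{k_i}·(a + b − c + 1 − |N| + x_i)_{k_i}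 ] ] = (c − a)_{|N|}·(c − b)_{|N|} / ∏_{i=1}^n [ (c + x_i)_{N_i}·(c − a − b + |N| − N_i − x_i)_{N_i} ]. -/
open Finset

/-- The shifted factorial (Pochhammer symbol) `(a)_k = a (a+1) ⋯ (a+k-1)`. -/
noncomputable def poch (a : ℂ) (k : ℕ) : ℂ := ∏ i ∈ Finset.range k, (a + i)

/-- The Newton-type polynomial `(x + a)(x + a - 1) ⋯ (x + a - j + 1)`. -/
noncomputable def newton (a : ℂ) (j : ℕ) (x : ℂ) : ℂ := ∏ l ∈ range j, (x + a - l)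

theorem newton_succ (a : ℂ) (j : ℕ) (x : ℂ) :
    newton a (j + 1) x = newton a j x * (x + a - j) := prod_range_succ _ _

theorem mul_newton_sub_one (a : ℂ) (j : ℕ) (x : ℂ) :
    (x + a) * newton a j (x - 1) = newton a j x * (x + a - j) := by
  rw [← newton_succ, newton, newton, prod_range_succ', mul_comm]
  congr 1
  · refine prod_congr rfl fun l _ => ?_
    push_cast
    ring
  · simp

theorem det_newton {m : ℕ} (a : ℂ) (y : Fin m → ℂ) :
    (Matrix.of fun i j : Fin m => newton a j (y i)).det = (Matrix.vandermonde y).det := by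
  have hmonic (l : ℕ) : (Polynomial.X + Polynomial.C (a - l)).Monic :=
    Polynomial.monic_X_add_C _
  rw [Matrix.det_eval_matrixOfPolynomials_eq_det_vandermonde y
    (fun j => ∏ l ∈ range j, (Polynomial.X + Polynomial.C (a - l)))]
  · congr 1
    ext i j
    simp [newton, Polynomial.eval_prod, add_sub_assoc]
  · intro i
    rw [Polynomial.natDegree_prod_of_monic _ _ fun l _ => hmonic l]
    simp only [Polynomial.natDegree_X_add_C, sum_const, card_range, smul_eq_mul, mul_one]
  · exact fun i => Polynomial.monic_prod_of_monic _ _ fun l _ => hmonic l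

/-- The difference operator `p ↦ (c + x)(d + x) p(x) - (a + x)(b + x) p(x - 1)` is bidiagonal in
the basis `newton a`, when `c + d = a + b + 1 - m`. -/
theorem difference_newton {a b c d m : ℂ} (h : c + d = a + b + 1 - m) (j : ℕ) (x : ℂ) :
    (c + x) * (d + x) * newton a j x - (a + x) * (b + x) * newton a j (x - 1) =
      (j + 1 - m) * newton a (j + 1) x + (c - a + j) * (d - a + j) * newton a j x := by
  rw [newton_succ]
  obtain rfl : m = a + b + 1 - c - d := by linear_combination h
  linear_combination (-(b + x)) * mul_newton_sub_one a j x

theorem det_difference_newton {m : ℕ} {a b c d : ℂ} (h : c + d = a + b + 1 - m)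
    (y : Fin m → ℂ) :
    (Matrix.of fun i j : Fin m => (c + y i) * (d + y i) * newton a j (y i) -
        (a + y i) * (b + y i) * newton a j (y i - 1)).det =
      (∏ j ∈ range m, (c - a + j) * (d - a + j)) * (Matrix.vandermonde y).det := by
  let C : Matrix (Fin m) (Fin m) ℂ := Matrix.of fun l j =>
    (if (l : ℕ) = j + 1 then (j + 1 - m : ℂ) else 0) +
      if l = j then (c - a + j) * (d - a + j) else 0
  have hC : C.det = ∏ j ∈ range m, (c - a + j) * (d - a + j) := by
    rw [Matrix.det_of_isLowerTriangular, ← Fin.prod_univ_eq_prod_range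
      (fun j => (c - a + j) * (d - a + j))]
    · exact prod_congr rfl fun j _ => by simp [C]
    · intro l j hlj
      have hlj : l < j := hlj
      have h1 : ¬ (l : ℕ) = j + 1 := by have := Fin.lt_def.1 hlj; omega
      simp [C, h1, hlj.ne]
  rw [← hC, ← det_newton a y, mul_comm C.det, ← Matrix.det_mul]
  congr 1
  ext i j
  rw [Matrix.of_apply, difference_newton h, Matrix.mul_apply]
  simp only [Matrix.of_apply, C, mul_add (newton a _ _), sum_add_distrib, mul_ite, mul_zero,
    sum_ite_eq', mem_univ, if_true]
  rw [mul_comm (newton a j (y i)) (_ * _)]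
  congr 1
  by_cases hj : (j : ℕ) + 1 < m
  · rw [sum_eq_single (⟨j + 1, hj⟩ : Fin m)]
    · simp [mul_comm]
    · intro l _ hl
      exact if_neg fun h' => hl (Fin.ext h')
    · simp
  · have hm : (m : ℂ) = j + 1 := by
      have : m = (j : ℕ) + 1 := by omega
      exact_mod_cast this
    rw [hm, sub_self, zero_mul]
    simp

/-- Expansion of the determinant of a sum of two scaled Newton matrices over row subsets. -/
theorem det_newton_add {m : ℕ} (a : ℂ) (u v y z : Fin m → ℂ) :
    (Matrix.of fun i j : Fin m => u i * newton a j (y i) + v i * newton a j (z i)).det =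
      ∑ s : Finset (Fin m), (∏ i, if i ∈ s then u i else v i) *
        (Matrix.vandermonde fun i => if i ∈ s then y i else z i).det := by
  have := (Matrix.detRowAlternating (n := Fin m) (R := ℂ)).toMultilinearMap.map_add_univ
    (fun i j => u i * newton a j (y i)) (fun i j => v i * newton a j (z i))
  refine this.trans (sum_congr rfl fun s _ => ?_)
  rw [← det_newton a, ← smul_eq_mul]
  refine Eq.trans ?_ ((Matrix.detRowAlternating (n := Fin m)
    (R := ℂ)).toMultilinearMap.map_smul_univ _ _)
  congr 1
  ext i j
  by_cases hi : i ∈ s <;> simp [hi]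

theorem prod_prod_eq_diag_mul_Ioi {m : ℕ} (F : Fin m → Fin m → ℂ) :
    ∏ i, ∏ j, F i j = (∏ i, F i i) * ∏ i, ∏ j ∈ Ioi i, F i j * F j i := by
  rw [prod_prod_Ioi_mul_eq_prod_prod_off_diag fun i j => F j i, ← prod_mul_distrib]
  exact prod_congr rfl fun i _ => Fintype.prod_eq_mul_prod_compl i (F i)

theorem vandermonde_shift_ratio {m : ℕ} {y : Fin m → ℂ} (hy : Function.Injective y)
    (s : Finset (Fin m)) :
    (Matrix.vandermonde fun i => if i ∈ s then y i - 1 else y i).det =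
      (∏ i, ∏ j, if i ∈ s ∧ j ∉ s then (y i - y j - 1) / (y i - y j) else 1) *
        (Matrix.vandermonde y).det := by
  rw [prod_prod_eq_diag_mul_Ioi, Matrix.det_vandermonde, Matrix.det_vandermonde]
  have hdiag : (∏ i, if i ∈ s ∧ i ∉ s then (y i - y i - 1) / (y i - y i) else 1) = 1 :=
    prod_eq_one fun i _ => by simp
  rw [hdiag, one_mul, ← prod_mul_distrib]
  refine prod_congr rfl fun i _ => ?_
  rw [← prod_mul_distrib]
  refine prod_congr rfl fun j hj => ?_
  have hij : i ≠ j := (mem_Ioi.1 hj).ne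
  have h1 : y i - y j ≠ 0 := sub_ne_zero.2 (hy.ne hij)
  have h2 : y j - y i ≠ 0 := sub_ne_zero.2 (hy.ne hij.symm)
  by_cases hi : i ∈ s <;> by_cases hj : j ∈ s <;> simp [hi, hj] <;> field_simp <;> ring

theorem sum_finset_fin {m : ℕ} {a b c d : ℂ} (h : c + d = a + b + 1 - m)
    {y : Fin m → ℂ} (hy : Function.Injective y) :
    ∑ s : Finset (Fin m),
      (∏ i, if i ∈ s then -((a + y i) * (b + y i)) else (c + y i) * (d + y i)) *
        (∏ i, ∏ j, if i ∈ s ∧ j ∉ s then (y i - y j - 1) / (y i - y j) else 1) =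
      ∏ j ∈ range m, (c - a + j) * (d - a + j) := by
  have hV := Matrix.det_vandermonde_ne_zero_iff.2 hy
  apply mul_right_cancel₀ hV
  rw [← det_difference_newton h, sum_mul]
  have := det_newton_add a (fun i => -((a + y i) * (b + y i)))
    (fun i => (c + y i) * (d + y i)) (fun i => y i - 1) y
  refine Eq.trans ?_ (this.symm.trans ?_)
  · refine sum_congr rfl fun s _ => ?_
    rw [vandermonde_shift_ratio hy, mul_assoc]
  · congr 1
    ext i j
    simp only [Matrix.of_apply]
    ring

theorem sum_finset {ι : Type*} [Fintype ι] [DecidableEq ι] {a b c d : ℂ}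
    (h : c + d = a + b + 1 - Fintype.card ι) {y : ι → ℂ} (hy : Function.Injective y) :
    ∑ s : Finset ι,
      (∏ i, if i ∈ s then -((a + y i) * (b + y i)) else (c + y i) * (d + y i)) *
        (∏ i, ∏ j, if i ∈ s ∧ j ∉ s then (y i - y j - 1) / (y i - y j) else 1) =
      ∏ j ∈ range (Fintype.card ι), (c - a + j) * (d - a + j) := by
  let e := Fintype.equivFin ι
  rw [← sum_finset_fin h (hy.comp e.symm.injective)]
  refine Fintype.sum_equiv e.finsetCongr _ _ fun s => ?_
  congr 1
  · exact Fintype.prod_equiv e _ _ fun i => by simp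
  · exact Fintype.prod_equiv e _ _ fun i => Fintype.prod_equiv e _ _ fun j => by simp

theorem poch_add (a : ℂ) (k l : ℕ) : poch a (k + l) = poch a k * poch (a + k) l := by
  simp only [poch, prod_range_add]
  congr 1
  refine prod_congr rfl fun i _ => ?_
  push_cast
  ring

theorem poch_one (a : ℂ) : poch a 1 = a := by simp [poch]

theorem poch_eq_zero {a : ℂ} {k i : ℕ} (hi : i < k) (h : a + i = 0) : poch a k = 0 :=
  prod_eq_zero (mem_range.2 hi) h

theorem poch_reflect (a : ℂ) (k : ℕ) : poch (1 - a - k) k = (-1) ^ k * poch a k := by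
  rw [poch, ← prod_range_reflect, poch]
  conv_rhs => rw [← card_range k, ← prod_const, card_range, ← prod_mul_distrib]
  refine prod_congr rfl fun i hi => ?_
  have hi := mem_range.1 hi
  have : ((k - 1 - i : ℕ) : ℂ) = k - 1 - i := by
    rw [Nat.cast_sub (by omega), Nat.cast_sub (by omega), Nat.cast_one]
  rw [this]
  ring

theorem poch_pair (d : ℂ) (k l : ℕ) :
    poch (1 + d) k * poch (1 - d) l * d =
      poch (d - l) k * poch (-d - k) l * (d + k - l) := by
  have h1 := poch_add (d - l) (l + 1) k
  have h2 := poch_add (d - l) (k + 1) l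
  rw [show k + 1 + l = l + 1 + k by ring, h1, poch_add, poch_one, poch_add, poch_one] at h2
  have h3 := poch_reflect (d - l) l
  have h4 := poch_reflect (1 + d + k - l) l
  rw [show 1 - (d - l) - l = 1 - d by ring] at h3
  rw [show 1 - (1 + d + k - l) - l = -d - k by ring] at h4
  rw [show d - l + (l + 1 : ℕ) = 1 + d by push_cast; ring,
    show d - l + (k + 1 : ℕ) = 1 + d + k - l by push_cast; ring] at h2
  rw [h3, h4]
  linear_combination (-1) ^ l * h2

theorem prod_range_ite_lt {k N : ℕ} (h : k ≤ N) (A : ℕ → ℂ) :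
    (∏ t ∈ range N, if t < k then A t else 1) = ∏ t ∈ range k, A t := by
  rw [← prod_filter]
  congr 1
  ext t
  simp only [mem_filter, mem_range]
  omega

theorem prod_range_telescope {k N : ℕ} (h : k ≤ N) (u : ℂ)
    (hu : ∀ t, k ≤ t → t ≤ N → u - t ≠ 0) :
    (∏ t ∈ range N, if t < k then 1 else (u - t - 1) / (u - t)) = (u - N) / (u - k) := by
  induction N, h using Nat.le_induction with
  | base =>
    rw [div_self (hu k le_rfl le_rfl)]
    exact prod_eq_one fun t ht => if_pos (mem_range.1 ht)
  | succ N hN ih =>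
    rw [prod_range_succ, ih fun t h1 h2 => hu t h1 (h2.trans N.le_succ), if_neg hN.not_gt,
      div_mul_div_comm, mul_comm (u - k), mul_div_mul_left _ _ (hu N hN N.le_succ)]
    push_cast
    ring

section Strings

variable {n : ℕ} {N : Fin n → ℕ} {x : Fin n → ℂ}

/-- The points `x i, x i + 1, …, x i + N i - 1` for all `i`. -/
noncomputable def stringPoint (N : Fin n → ℕ) (x : Fin n → ℂ) (p : Σ i, Fin (N i)) : ℂ :=
  x p.1 + (p.2 : ℕ)

/-- The first `k i` points of each string. -/
def initialSegments (N k : Fin n → ℕ) : Finset (Σ i, Fin (N i)) :=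
  univ.filter fun p => (p.2 : ℕ) < k p.1

theorem mem_initialSegments {k : Fin n → ℕ} {p : Σ i, Fin (N i)} :
    p ∈ initialSegments N k ↔ (p.2 : ℕ) < k p.1 := by
  simp [initialSegments]

/-- No point of a string, nor the point right after it, belongs to another string. -/
def StringsSeparated (N : Fin n → ℕ) (x : Fin n → ℂ) : Prop :=
  ∀ ⦃i j : Fin n⦄ ⦃s t : ℕ⦄, s < N i → t ≤ N j → x i - x j + s - t = 0 → i = j ∧ s = t

theorem stringsSeparated (hxd : ∀ i j : Fin n, i ≠ j → x i ≠ x j)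
    (h1 : ∀ i j : Fin n, ∀ m ≤ N i, poch (1 + x i - x j) m ≠ 0) :
    StringsSeparated N x := by
  intro i j s t hs ht h
  by_cases hij : i = j
  · subst hij
    refine ⟨rfl, ?_⟩
    have : (s : ℂ) = t := by linear_combination h
    exact_mod_cast this
  · exfalso
    rcases lt_trichotomy s t with hst | rfl | hst
    · refine h1 j i (N j) le_rfl (poch_eq_zero (i := t - s - 1) (by omega) ?_)
      rw [Nat.cast_sub (by omega), Nat.cast_sub (by omega)]
      push_cast
      linear_combination -h
    · exact hxd i j hij (by linear_combination h)
    · refine h1 i j (N i) le_rfl (poch_eq_zero (i := s - t - 1) (by omega) ?_)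
      rw [Nat.cast_sub (by omega), Nat.cast_sub (by omega)]
      push_cast
      linear_combination h

theorem stringPoint_injective (H : StringsSeparated N x) :
    Function.Injective (stringPoint N x) := by
  rintro ⟨i, s⟩ ⟨j, t⟩ h
  have h : x i + (s : ℕ) = x j + (t : ℕ) := h
  obtain ⟨rfl, hst⟩ := H s.2 t.2.le (by linear_combination h)
  rw [Fin.ext hst]

theorem prod_initialSegments (H : StringsSeparated N x) {k : Fin n → ℕ} (hk : ∀ i, k i ≤ N i) :
    (∏ p, ∏ q, if p ∈ initialSegments N k ∧ q ∉ initialSegments N k then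
      (stringPoint N x p - stringPoint N x q - 1) / (stringPoint N x p - stringPoint N x q)
      else 1) =
    ∏ i, ∏ j, poch (-(N j : ℂ) + x i - x j) (k i) / poch (x i - x j - k j) (k i) := by
  simp only [Fintype.prod_sigma, mem_initialSegments, stringPoint]
  refine prod_congr rfl fun i _ => ?_
  rw [prod_comm]
  refine prod_congr rfl fun j _ => ?_
  rw [Fin.prod_univ_eq_prod_range (fun s => ∏ t : Fin (N j), if s < k i ∧ ¬ (t : ℕ) < k j then
    (x i + (s : ℂ) - (x j + (t : ℕ)) - 1) / (x i + (s : ℂ) - (x j + (t : ℕ))) else 1) (N i)]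
  rw [poch, poch, ← prod_div_distrib, ← prod_range_ite_lt (hk i)]
  refine prod_congr rfl fun s hs => ?_
  by_cases hsk : s < k i
  · rw [Fin.prod_univ_eq_prod_range (fun t => if s < k i ∧ ¬ t < k j then
      (x i + (s : ℂ) - (x j + (t : ℂ)) - 1) / (x i + (s : ℂ) - (x j + (t : ℂ))) else 1) (N j)]
    have := prod_range_telescope (hk j) (x i - x j + s) fun t h1 h2 h0 => by
      obtain ⟨rfl, rfl⟩ := H (mem_range.1 hs) h2 h0
      omega
    rw [if_pos hsk]
    refine Eq.trans (prod_congr rfl fun t _ => ?_) (this.trans ?_)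
    · by_cases htk : t < k j
      · simp [htk]
      · simp only [hsk, htk, not_false_eq_true, and_self, if_true, if_false]
        ring
    · ring
  · simp [hsk]

theorem prod_initialSegments_eq (H : StringsSeparated N x) {k : Fin n → ℕ} (hk : ∀ i, k i ≤ N i)
    (hxd : ∀ i j : Fin n, i ≠ j → x i ≠ x j)
    (h1 : ∀ i j : Fin n, ∀ m ≤ N i, poch (1 + x i - x j) m ≠ 0) :
    (∏ i, ∏ j, if i < j then
          (x i + (k i : ℂ) - x j - (k j : ℂ)) / (x i - x j) else 1) *
        (∏ i, ∏ j, poch (-(N j : ℂ) + x i - x j) (k i) / poch (1 + x i - x j) (k i)) =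
    (∏ i, (-1) ^ k i) *
      ∏ i, ∏ j, poch (-(N j : ℂ) + x i - x j) (k i) / poch (x i - x j - k j) (k i) := by
  have hQ (i j : Fin n) : poch (x i - x j - k j) (k i) ≠ 0 := by
    refine prod_ne_zero_iff.2 fun s hs h0 => ?_
    have hs := mem_range.1 hs
    obtain ⟨rfl, rfl⟩ := H (hs.trans_le (hk i)) (hk j) (by linear_combination h0)
    exact lt_irrefl _ hs
  have key : (∏ i, ∏ j, if i < j then
      (x i + (k i : ℂ) - x j - (k j : ℂ)) / (x i - x j) else 1) =
      (∏ i, (-1) ^ k i) *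
        ∏ i, ∏ j, poch (1 + x i - x j) (k i) / poch (x i - x j - k j) (k i) := by
    rw [prod_prod_eq_diag_mul_Ioi
      fun i j => poch (1 + x i - x j) (k i) / poch (x i - x j - k j) (k i),
      ← mul_assoc, ← prod_mul_distrib]
    have hdiag : (∏ i, (-1) ^ k i * (poch (1 + x i - x i) (k i) /
        poch (x i - x i - k i) (k i))) = 1 := by
      refine prod_eq_one fun i _ => ?_
      have h := poch_reflect 1 (k i)
      have hne := hQ i i
      rw [sub_self] at h
      rw [sub_self] at hne
      rw [add_sub_cancel_right, sub_self, ← mul_div_assoc, ← h, div_self hne]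
    rw [hdiag, one_mul]
    refine prod_congr rfl fun i _ => ?_
    rw [← prod_filter, filter_lt_eq_Ioi]
    refine prod_congr rfl fun j hj => ?_
    have hij := (mem_Ioi.1 hj).ne
    have h := poch_pair (x i - x j) (k i) (k j)
    have h2 := hQ j i
    have e1 : 1 + x j - x i = 1 - (x i - x j) := by ring
    have e2 : x j - x i - k i = -(x i - x j) - k i := by ring
    rw [e2] at h2
    rw [add_sub_assoc 1 (x i), e1, e2, div_mul_div_comm,
      div_eq_div_iff (sub_ne_zero.2 (hxd i j hij)) (mul_ne_zero (hQ i j) h2), h]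
    ring
  rw [key, mul_assoc, ← prod_mul_distrib]
  congr 1
  refine prod_congr rfl fun i _ => ?_
  rw [← prod_mul_distrib]
  refine prod_congr rfl fun j _ => ?_
  have := h1 i j (k i) (hk i)
  field_simp

theorem exists_eq_initialSegments {s : Finset (Σ i, Fin (N i))}
    (hs : ∀ i (t : ℕ) (ht : t + 1 < N i), (⟨i, t + 1, ht⟩ : Σ i, Fin (N i)) ∈ s →
      (⟨i, t, t.lt_succ_self.trans ht⟩ : Σ i, Fin (N i)) ∈ s) :
    ∃ k : Fin n → ℕ, (∀ i, k i ≤ N i) ∧ initialSegments N k = s := by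
  classical
  have hex (i : Fin n) : ∃ t : ℕ, ∀ h : t < N i, (⟨i, t, h⟩ : Σ i, Fin (N i)) ∉ s :=
    ⟨N i, fun h => absurd h (lt_irrefl _)⟩
  refine ⟨fun i => Nat.find (hex i), fun i =>
    Nat.find_min' _ fun h => absurd h (lt_irrefl _), ?_⟩
  ext ⟨i, t, ht⟩
  rw [mem_initialSegments]
  constructor
  · intro h
    have := Nat.find_min (hex i) h
    push Not at this
    exact this.2
  · intro h
    by_contra! hle
    have hdown : ∀ l, Nat.find (hex i) ≤ l → ∀ h : l < N i,
        (⟨i, l, h⟩ : Σ i, Fin (N i)) ∉ s := by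
      intro l hl
      induction l, hl using Nat.le_induction with
      | base => exact Nat.find_spec (hex i)
      | succ l _ ih => exact fun hlt hmem => ih _ (hs i l hlt hmem)
    exact hdown t hle ht h

theorem prod_stringPoint_eq_zero {s : Finset (Σ i, Fin (N i))}
    (hs : ∀ k : Fin n → ℕ, (∀ i, k i ≤ N i) → initialSegments N k ≠ s) :
    (∏ p, ∏ q, if p ∈ s ∧ q ∉ s then
      (stringPoint N x p - stringPoint N x q - 1) / (stringPoint N x p - stringPoint N x q)
      else 1) = 0 := by
  by_contra hne
  obtain ⟨k, hk, rfl⟩ := exists_eq_initialSegments (s := s) fun i t ht hmem => by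
    by_contra hnot
    refine hne (prod_eq_zero (mem_univ ⟨i, t + 1, ht⟩)
      (prod_eq_zero (mem_univ ⟨i, t, t.lt_succ_self.trans ht⟩) ?_))
    rw [if_pos ⟨hmem, hnot⟩]
    simp [stringPoint]
  exact hs k hk rfl

theorem initialSegments_injOn :
    Set.InjOn (initialSegments N) (Fintype.piFinset fun i => range (N i + 1)) := by
  intro k hk l hl hkl
  have hk := fun i => mem_range.1 (Fintype.mem_piFinset.1 hk i)
  have hl := fun i => mem_range.1 (Fintype.mem_piFinset.1 hl i)
  have hiff (i : Fin n) (t : ℕ) (ht : t < N i) : t < k i ↔ t < l i := by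
    have := Finset.ext_iff.1 hkl ⟨i, t, ht⟩
    simpa only [mem_initialSegments] using this
  funext i
  have hki := hk i
  have hli := hl i
  rcases lt_trichotomy (k i) (l i) with h | h | h
  · have := hiff i (k i) (by omega)
    omega
  · exact h
  · have := hiff i (l i) (by omega)
    omega

theorem prod_weights (a b c d : ℂ) {k : Fin n → ℕ} (hk : ∀ i, k i ≤ N i)
    (hc : ∀ i, poch (c + x i) (N i) ≠ 0) (hd : ∀ i, poch (d + x i) (N i) ≠ 0) :
    (∏ p, if p ∈ initialSegments N k then
        -((a + stringPoint N x p) * (b + stringPoint N x p))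
      else (c + stringPoint N x p) * (d + stringPoint N x p)) =
    (∏ i, (-1) ^ k i) * (∏ i, (poch (a + x i) (k i) * poch (b + x i) (k i)) /
      (poch (c + x i) (k i) * poch (d + x i) (k i))) *
      ∏ i, poch (c + x i) (N i) * poch (d + x i) (N i) := by
  simp only [Fintype.prod_sigma, mem_initialSegments, stringPoint]
  rw [← prod_mul_distrib, ← prod_mul_distrib]
  refine prod_congr rfl fun i _ => ?_
  rw [Fin.prod_univ_eq_prod_range (fun t => if t < k i then
    -((a + (x i + (t : ℂ))) * (b + (x i + (t : ℂ)))) else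
      (c + (x i + (t : ℂ))) * (d + (x i + (t : ℂ)))) (N i)]
  have hc := prod_ne_zero_iff.1 (hc i)
  have hd := prod_ne_zero_iff.1 (hd i)
  simp only [poch]
  conv_rhs => rw [← card_range (k i), ← prod_const, card_range]
  simp only [← prod_mul_distrib, ← prod_div_distrib]
  rw [← prod_range_ite_lt (hk i), ← prod_mul_distrib]
  refine prod_congr rfl fun t ht => ?_
  have hc := hc t ht
  have hd := hd t ht
  by_cases htk : t < k i
  · simp only [htk, if_true, ← add_assoc]
    field_simp
  · simp only [htk, if_false, ← add_assoc, one_mul]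

end Strings

/-- Holman's `A_n` Pfaff–Saalschütz summation. -/
theorem stmt_6 (n : ℕ) (hn : 0 < n) (N : Fin n → ℕ)
    (a b c : ℂ) (x : Fin n → ℂ)
    (hxd : ∀ i j : Fin n, i ≠ j → x i ≠ x j)
    (h1 : ∀ i j : Fin n, ∀ m ≤ N i, poch (1 + x i - x j) m ≠ 0)
    (h2 : ∀ i : Fin n, ∀ m ≤ N i, poch (c + x i) m ≠ 0)
    (h3 : ∀ i : Fin n, ∀ m ≤ N i,
      poch (a + b - c + 1 - (∑ j, (N j : ℂ)) + x i) m ≠ 0)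
    (h4 : ∀ i : Fin n,
      poch (c - a - b + (∑ j, (N j : ℂ)) - (N i : ℂ) - x i) (N i) ≠ 0) :
    ∑ k ∈ Fintype.piFinset (fun i => Finset.range (N i + 1)),
      ((∏ i, ∏ j, if i < j then
          (x i + (k i : ℂ) - x j - (k j : ℂ)) / (x i - x j) else 1) *
        (∏ i, ∏ j, poch (-(N j : ℂ) + x i - x j) (k i) / poch (1 + x i - x j) (k i)) *
        ∏ i, (poch (a + x i) (k i) * poch (b + x i) (k i)) /
          (poch (c + x i) (k i) *
            poch (a + b - c + 1 - (∑ j, (N j : ℂ)) + x i) (k i))) =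
      poch (c - a) (∑ i, N i) * poch (c - b) (∑ i, N i) /
        ∏ i, (poch (c + x i) (N i) *
          poch (c - a - b + (∑ j, (N j : ℂ)) - (N i : ℂ) - x i) (N i)) := by
  have H := stringsSeparated hxd h1
  set d : ℂ := a + b - c + 1 - ∑ j, (N j : ℂ) with hd
  have hcN : ∀ i, poch (c + x i) (N i) ≠ 0 := fun i => h2 i _ le_rfl
  have hdN : ∀ i, poch (d + x i) (N i) ≠ 0 := fun i => h3 i _ le_rfl
  have hZ : ∏ i, poch (c + x i) (N i) * poch (d + x i) (N i) ≠ 0 :=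
    prod_ne_zero_iff.2 fun i _ => mul_ne_zero (hcN i) (hdN i)
  have hcard : Fintype.card (Σ i, Fin (N i)) = ∑ i, N i := by simp
  have hsum := sum_finset (ι := Σ i, Fin (N i)) (a := a) (b := b) (c := c) (d := d)
    (by rw [hcard, hd]; push_cast; ring) (stringPoint_injective H)
  apply mul_right_cancel₀ hZ
  rw [sum_mul]
  refine Eq.trans (sum_of_injOn (initialSegments N) initialSegments_injOn
    (fun _ _ => mem_coe.2 (mem_univ _)) ?_ ?_) (hsum.trans ?_)
  · intro s _ hs
    rw [prod_stringPoint_eq_zero, mul_zero]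
    exact fun k hk hks => hs ⟨k, mem_coe.2 (Fintype.mem_piFinset.2 fun i =>
      mem_range.2 (Nat.lt_succ_of_le (hk i))), hks⟩
  · intro k hk
    have hk (i : Fin n) : k i ≤ N i :=
      Nat.le_of_lt_succ (mem_range.1 (Fintype.mem_piFinset.1 hk i))
    rw [prod_weights a b c d hk hcN hdN, prod_initialSegments H hk,
      prod_initialSegments_eq H hk hxd h1]
    ring
  · have hden : (∏ i, (poch (c + x i) (N i) *
        poch (c - a - b + (∑ j, (N j : ℂ)) - (N i : ℂ) - x i) (N i))) =
        (-1) ^ (∑ i, N i) * ∏ i, poch (c + x i) (N i) * poch (d + x i) (N i) := by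
      rw [← prod_pow_eq_pow_sum, ← prod_mul_distrib]
      refine prod_congr rfl fun i _ => ?_
      rw [mul_left_comm, ← poch_reflect, hd]
      congr 2
      ring
    have hnum : ∏ j ∈ range (∑ i, N i), (c - a + j) * (d - a + j) =
        poch (c - a) (∑ i, N i) * ((-1) ^ (∑ i, N i) * poch (c - b) (∑ i, N i)) := by
      rw [← poch_reflect, poch, poch, ← prod_mul_distrib]
      refine prod_congr rfl fun j _ => ?_
      rw [hd]
      push_cast
      ring
    rw [hcard, hnum, hden]
    have hsq : ((-1 : ℂ) ^ (∑ i, N i)) * (-1) ^ (∑ i, N i) = 1 := by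
      rw [← mul_pow]; simp
    rw [div_mul_eq_mul_div, mul_div_mul_right _ _ hZ,
      eq_div_iff (pow_ne_zero _ (by norm_num))]
    linear_combination poch (c - a) (∑ i, N i) * poch (c - b) (∑ i, N i) * hsq
end

section
/- Terminating A_n q-binomial theorem (rectangular sum, version 1): Let n be a positive integer, N_1, …, N_n nonnegative integers with |N| = N_1 + ⋯ + N_n, q a nonzero complex number that is not a root of unity, z a complex number, and x_1, …, x_n nonzero complex numbers such that x_i/x_j is not an integer power of q for i ≠ j. Then (z; q)_{|N|} = ∑_{k_1=0}^{N_1} ⋯ ∑_{k_n=0}^{N_n} ∏_{i,j=1}^n (q·x_i/x_j; q)_{N_i} / [ (q·x_i/x_j; q)_{k_i} · (q^{1+k_i−k_j}·x_i/x_j; q)_{N_i−k_i} ] · (−1)^{|k|}·q^{|k|(|k|−1)/2}·z^{|k|}, where |k| = k_1 + ⋯ + k_n. -/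
open Finset

theorem sum_pow_card_mul_det_vandermonde {R : Type*} [CommRing R] {M : ℕ} (q w : R)
    (v : Fin M → R) :
    ∑ I : Finset (Fin M), w ^ #I *
        (Matrix.vandermonde fun a => if a ∈ I then q * v a else v a).det =
      (∏ j ∈ range M, (1 + w * q ^ j)) * (Matrix.vandermonde v).det := by
  have h := (Matrix.detRowAlternating (n := Fin M) (R := R)).toMultilinearMap.map_add_univ
    (w • Matrix.vandermonde fun a => q * v a) (Matrix.vandermonde v)
  have hl : (w • Matrix.vandermonde fun a => q * v a) + Matrix.vandermonde v =
      Matrix.vandermonde v * Matrix.diagonal fun j : Fin M => 1 + w * q ^ (j : ℕ) := by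
    ext a j
    simp [Matrix.mul_diagonal, Matrix.vandermonde_apply]
    ring
  change Matrix.det ((w • Matrix.vandermonde fun a => q * v a) + Matrix.vandermonde v) =
    ∑ I : Finset (Fin M), Matrix.det _ at h
  rw [hl] at h
  rw [Matrix.det_mul, Matrix.det_diagonal, Fin.prod_univ_eq_prod_range (fun j => 1 + w * q ^ j),
    mul_comm] at h
  rw [h]
  refine sum_congr rfl fun I _ => ?_
  rw [← prod_const, ← prod_ite_mem_eq I (fun _ => w), ← Matrix.det_mul_column]
  congr 1
  ext a j
  by_cases ha : a ∈ I
  · refine Eq.trans ?_ (congrFun (I.piecewise_eq_of_mem (π := fun _ => Fin M → R)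
      (w • Matrix.vandermonde fun a => q * v a) (Matrix.vandermonde v) ha) j).symm
    simp [ha, Matrix.vandermonde_apply]
  · refine Eq.trans ?_ (congrFun (I.piecewise_eq_of_notMem (π := fun _ => Fin M → R)
      (w • Matrix.vandermonde fun a => q * v a) (Matrix.vandermonde v) ha) j).symm
    simp [ha, Matrix.vandermonde_apply]

theorem prod_prod_filter_lt_const {ι M : Type*} [LinearOrder ι] [CommMonoid M] (q : M)
    (s : Finset ι) : ∏ i ∈ s, ∏ j ∈ s with i < j, q = q ^ (#s).choose 2 := by
  induction s using Finset.induction_on_max with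
  | empty => simp
  | insert m s hm ih =>
    have hms : m ∉ s := fun h => lt_irrefl _ (hm m h)
    have h1 : ({j ∈ insert m s | m < j} : Finset ι) = ∅ := by
      ext j
      simp only [mem_filter, mem_insert, notMem_empty, iff_false, not_and, not_lt]
      rintro (rfl | h)
      · exact le_rfl
      · exact (hm j h).le
    rw [prod_insert hms, h1, prod_empty, one_mul, card_insert_of_notMem hms,
      Nat.choose_succ_succ' _ 1, Nat.choose_one_right, pow_add, ← ih, ← prod_const,
      ← prod_mul_distrib]
    refine prod_congr rfl fun i hi => ?_
    rw [filter_insert, if_pos (hm i hi), prod_insert (by simp [hms])]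

theorem det_vandermonde_ite_mul {K : Type*} [Field K] {M : ℕ} (q : K) (v : Fin M → K)
    (hv : Function.Injective v) (I : Finset (Fin M)) :
    (Matrix.vandermonde fun a => if a ∈ I then q * v a else v a).det =
      q ^ (#I).choose 2 * (∏ a ∈ I, ∏ b ∈ Iᶜ, (q * v a - v b) / (v a - v b)) *
        (Matrix.vandermonde v).det := by
  have hsub : ∀ a b, a ≠ b → v a - v b ≠ 0 := fun a b h => sub_ne_zero.2 (hv.ne h)
  have hfac : ∏ a ∈ I, ∏ b ∈ Iᶜ, (q * v a - v b) / (v a - v b) =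
      (∏ a, ∏ b ∈ Ioi a, if a ∈ I ∧ b ∉ I then (q * v a - v b) / (v a - v b) else 1) *
      ∏ a, ∏ b ∈ Ioi a, if b ∈ I ∧ a ∉ I then (q * v b - v a) / (v b - v a) else 1 := by
    have hc : ∏ a, ∏ b ∈ Ioi a,
          (if b ∈ I ∧ a ∉ I then (q * v b - v a) / (v b - v a) else 1) =
        ∏ a, ∏ b ∈ Iio a,
          (if a ∈ I ∧ b ∉ I then (q * v a - v b) / (v a - v b) else 1) :=
      prod_comm' (by simp)
    rw [hc, ← prod_mul_distrib, ← prod_ite_mem_eq I]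
    refine prod_congr rfl fun a _ => ?_
    rw [mul_comm (∏ _ ∈ Ioi a, _), ← prod_union (disjoint_left.2 fun b hb hb' =>
      lt_asymm (mem_Iio.1 hb) (mem_Ioi.1 hb'))]
    split_ifs with ha
    · rw [← prod_filter_mul_prod_filter_not (Iio a ∪ Ioi a) (fun b => b ∉ I)]
      rw [prod_congr (s₂ := (Iio a ∪ Ioi a).filter (fun b => ¬ b ∉ I)) rfl
        (g := fun _ => (1 : K)) (by simp +contextual), prod_const_one, mul_one]
      refine prod_congr ?_ ?_
      · ext b
        simp only [mem_compl, mem_filter, mem_union, mem_Iio, mem_Ioi]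
        refine ⟨fun h => ⟨lt_or_gt_of_ne ?_, h⟩, fun h => h.2⟩
        rintro rfl
        exact h ha
      · intro b hb
        simp only [mem_filter] at hb
        simp [ha, hb.2]
    · simp [ha]
  have hq : q ^ (#I).choose 2 = ∏ a, ∏ b ∈ Ioi a, if a ∈ I ∧ b ∈ I then q else 1 := by
    rw [← prod_prod_filter_lt_const, ← prod_ite_mem_eq I]
    refine prod_congr rfl fun a _ => ?_
    split_ifs with ha
    · rw [← prod_filter]
      refine prod_congr ?_ fun _ _ => rfl
      ext b
      simp [ha, and_comm]
    · simp [ha]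
  rw [hfac, hq, Matrix.det_vandermonde, Matrix.det_vandermonde]
  simp only [← prod_mul_distrib]
  refine prod_congr rfl fun a _ => prod_congr rfl fun b hb => ?_
  have h1 := hsub a b (mem_Ioi.1 hb).ne
  have h2 := hsub b a (mem_Ioi.1 hb).ne'
  by_cases ha : a ∈ I <;> by_cases hb : b ∈ I <;> (simp [ha, hb]; try field_simp; try ring)

theorem sum_finset_prod_div_eq_prod {K σ : Type*} [Field K] [Fintype σ] [DecidableEq σ]
    (q w : K) (v : σ → K) (hv : Function.Injective v) :
    ∑ I : Finset σ, w ^ #I * q ^ (#I).choose 2 *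
        ∏ a ∈ I, ∏ b ∈ Iᶜ, (q * v a - v b) / (v a - v b) =
      ∏ j ∈ range (Fintype.card σ), (1 + w * q ^ j) := by
  let e := Fintype.equivFin σ
  have hu : Function.Injective (v ∘ e.symm) := hv.comp e.symm.injective
  have h := sum_pow_card_mul_det_vandermonde q w (v ∘ e.symm)
  simp only [det_vandermonde_ite_mul q _ hu, ← mul_assoc, ← sum_mul] at h
  rw [← mul_right_cancel₀ (Matrix.det_vandermonde_ne_zero_iff.2 hu) h]
  refine Fintype.sum_equiv e.finsetCongr _ _ fun I => ?_
  have hc : (I.map e.toEmbedding)ᶜ = Iᶜ.map e.toEmbedding := by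
    ext b
    simp [mem_map_equiv]
  simp [hc]

theorem prod_prod_div_eq_qPoch (q y : ℂ) (hq : q ≠ 0) {k K N : ℕ} (hK : K ≤ N)
    (h1 : ∀ t : ℕ, 1 - q ^ ((t : ℤ) + 1) * y ≠ 0)
    (h2 : ∀ s < k, ∀ t, K ≤ t → 1 - q ^ ((t : ℤ) - s) * y ≠ 0) :
    ∏ s ∈ range k, ∏ t ∈ Ico K N,
        (1 - q ^ ((t : ℤ) - s + 1) * y) / (1 - q ^ ((t : ℤ) - s) * y) =
      qPoch q (q * y) N /
        (qPoch q (q * y) K * qPoch q (q ^ (1 + (K : ℤ) - k) * y) (N - K)) := by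
  have htel : ∀ t, K ≤ t → ∀ m ≤ k, ∏ s ∈ range m,
      (1 - q ^ ((t : ℤ) - s + 1) * y) / (1 - q ^ ((t : ℤ) - s) * y) =
      (1 - q ^ ((t : ℤ) + 1) * y) / (1 - q ^ ((t : ℤ) + 1 - m) * y) := by
    intro t ht m
    induction m with
    | zero => simp [div_self (h1 t)]
    | succ m ih =>
      intro hm
      have hne : 1 - q ^ ((t : ℤ) - m + 1) * y ≠ 0 := by
        have := h2 m (by lia) (t + 1) (by lia)
        rwa [show ((t + 1 : ℕ) : ℤ) - m = t - m + 1 by push_cast; ring] at this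
      rw [prod_range_succ, ih (by lia), show (t : ℤ) + 1 - m = t - m + 1 by ring,
        div_mul_div_cancel₀ hne]
      congr 4
      push_cast
      ring
  have hterm : ∀ t : ℕ, 1 - q ^ ((t : ℤ) + 1) * y = 1 - q * y * q ^ t := by
    intro t
    rw [zpow_add_one₀ hq, zpow_natCast]
    ring
  have hK0 : qPoch q (q * y) K ≠ 0 := prod_ne_zero_iff.2 fun t _ => hterm t ▸ h1 t
  rw [prod_comm, prod_congr rfl fun t ht => htel t (mem_Ico.1 ht).1 k le_rfl, prod_div_distrib,
    ← div_div]
  congr 1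
  · rw [eq_div_iff hK0, mul_comm, prod_congr rfl fun t _ => hterm t]
    exact prod_range_mul_prod_Ico _ hK
  · rw [prod_Ico_eq_prod_range]
    refine prod_congr rfl fun t _ => ?_
    rw [mul_right_comm, ← zpow_natCast, ← zpow_add₀ hq]
    congr 3
    push_cast
    ring

@[to_additive]
theorem prod_filter_val_lt {M : Type*} [CommMonoid M] {ι : Type*} [Fintype ι]
    [DecidableEq ι] (N : ι → ℕ) (p : ι → ℕ → Prop) [∀ i s, Decidable (p i s)] (f : ι → ℕ → M) :
    ∏ a : (Σ i, Fin (N i)) with p a.1 a.2, f a.1 a.2 =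
      ∏ i, ∏ s ∈ range (N i) with p i s, f i s := by
  rw [prod_filter, Fintype.prod_sigma]
  refine prod_congr rfl fun i _ => ?_
  rw [prod_filter]
  exact Fin.prod_univ_eq_prod_range (fun s => if p i s then f i s else 1) (N i)

/-- A subset of a union of chains which is closed under predecessors is determined by the
lengths of its intersections with the chains. -/
theorem exists_eq_filter_val_lt {ι : Type*} [Fintype ι] [DecidableEq ι] (N : ι → ℕ)
    (I : Finset (Σ i, Fin (N i)))
    (hI : ∀ i s (hs : s + 1 < N i), (⟨i, s + 1, hs⟩ : Σ i, Fin (N i)) ∈ I →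
      (⟨i, s, by lia⟩ : Σ i, Fin (N i)) ∈ I) :
    ∃ k : ι → ℕ, (∀ i, k i ≤ N i) ∧ I = univ.filter fun a => (a.2 : ℕ) < k a.1 := by
  have hex : ∀ i, ∃ s, ∀ hs : s < N i, (⟨i, s, hs⟩ : Σ i, Fin (N i)) ∉ I :=
    fun i => ⟨N i, fun hs => absurd hs (lt_irrefl _)⟩
  classical
  refine ⟨fun i => Nat.find (hex i),
    fun i => Nat.find_min' _ fun hs => absurd hs (lt_irrefl _), ?_⟩
  ext ⟨i, s, hs⟩
  simp only [mem_filter, mem_univ, true_and]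
  constructor
  · have key : ∀ t, Nat.find (hex i) ≤ t → ∀ ht : t < N i,
        (⟨i, t, ht⟩ : Σ i, Fin (N i)) ∉ I := by
      intro t h
      induction t, h using Nat.le_induction with
      | base => exact Nat.find_spec (hex i)
      | succ t _ ih => exact fun ht hmem => ih (by lia) (hI i t ht hmem)
    contrapose!
    exact fun h => key s h hs
  · intro h
    have := Nat.find_min (hex i) h
    push Not at this
    exact this.2

/-- Terminating `A_n` q-binomial theorem (rectangular sum, version 1). -/
theorem stmt_7 (n : ℕ) (hn : 0 < n) (N : Fin n → ℕ) (q : ℂ) (hq : q ≠ 0)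
    (hqru : ∀ m : ℕ, 0 < m → q ^ m ≠ 1) (z : ℂ)
    (x : Fin n → ℂ) (hx : ∀ i, x i ≠ 0)
    (hxq : ∀ i j : Fin n, i ≠ j → ∀ m : ℤ, x i / x j ≠ q ^ m) :
    qPoch q z (∑ i, N i) =
      ∑ k ∈ Fintype.piFinset (fun i => Finset.range (N i + 1)),
        ((∏ i, ∏ j, qPoch q (q * x i / x j) (N i) /
            (qPoch q (q * x i / x j) (k i) *
              qPoch q (q ^ (1 + (k i : ℤ) - (k j : ℤ)) * x i / x j) (N i - k i))) *
          (-1) ^ (∑ i, k i) * q ^ Nat.choose (∑ i, k i) 2 * z ^ (∑ i, k i)) := by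
  have hqz : ∀ m : ℤ, m ≠ 0 → q ^ m ≠ 1 := by
    intro m hm h
    refine hqru m.natAbs (by lia) ?_
    rcases Int.natAbs_eq m with h' | h' <;> rw [h'] at h
    · exact_mod_cast h
    · rw [zpow_neg, inv_eq_one] at h
      exact_mod_cast h
  have hgen : ∀ (i j : Fin n) (m : ℤ), (i = j → m ≠ 0) → 1 - q ^ m * (x i / x j) ≠ 0 := by
    intro i j m hm h
    by_cases hij : i = j
    · subst hij
      rw [div_self (hx i), mul_one, sub_eq_zero] at h
      exact hqz m (hm rfl) h.symm
    · refine hxq i j hij (-m) ?_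
      rw [zpow_neg]
      exact eq_inv_of_mul_eq_one_right (sub_eq_zero.1 h).symm
  set v : (Σ i, Fin (N i)) → ℂ := fun a => (x a.1 * q ^ (a.2 : ℕ))⁻¹ with hv_def
  have hv : Function.Injective v := by
    rintro ⟨i, s⟩ ⟨j, t⟩ h
    have h' : x i * q ^ (s : ℕ) = x j * q ^ (t : ℕ) := inv_injective h
    have hm : ¬ (i = j → (s : ℤ) - t ≠ 0) := by
      intro hne
      refine hgen i j ((s : ℤ) - t) hne ?_
      rw [zpow_sub₀ hq, zpow_natCast, zpow_natCast]
      have := hx j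
      field_simp
      linear_combination -h'
    push Not at hm
    obtain ⟨rfl, hst⟩ := hm
    congr 1
    ext
    lia
  have hpair : ∀ (i j : Fin n) (s t : ℕ),
      (q * (x i * q ^ s)⁻¹ - (x j * q ^ t)⁻¹) / ((x i * q ^ s)⁻¹ - (x j * q ^ t)⁻¹) =
      (1 - q ^ ((t : ℤ) - s + 1) * (x j / x i)) / (1 - q ^ ((t : ℤ) - s) * (x j / x i)) := by
    intro i j s t
    have hi := hx i
    have hj := hx j
    rw [zpow_add₀ hq, zpow_sub₀ hq, zpow_natCast, zpow_natCast, zpow_one]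
    rw [← mul_div_mul_left (c := - (x j * q ^ t)) _ _ (by simp [hj, hq])]
    congr 1
    · field_simp
      ring
    · field_simp
      ring
  have hmain := sum_finset_prod_div_eq_prod q (-z) v hv
  rw [Fintype.card_sigma] at hmain
  simp only [Fintype.card_fin, neg_mul, ← sub_eq_add_neg] at hmain
  rw [qPoch, ← hmain]
  symm
  refine sum_of_injOn (fun k => univ.filter fun a => (a.2 : ℕ) < k a.1) ?_ (by simp) ?_ ?_
  · intro k hk l hl hkl
    simp only [mem_coe, Fintype.mem_piFinset, mem_range] at hk hl
    funext i
    by_contra hne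
    wlog hlt : k i < l i generalizing k l
    · exact this hkl.symm hl hk (Ne.symm hne) (by lia)
    have hi := hl i
    have := Finset.ext_iff.1 hkl ⟨i, k i, by lia⟩
    simp at this
    lia
  · intro I _ hI
    have : ∃ i s, ∃ hs : s + 1 < N i, (⟨i, s + 1, hs⟩ : Σ i, Fin (N i)) ∈ I ∧
        (⟨i, s, by lia⟩ : Σ i, Fin (N i)) ∉ I := by
      by_contra! hcon
      obtain ⟨k, hk, hIk⟩ := exists_eq_filter_val_lt N I hcon
      exact hI ⟨k, by simpa [Nat.lt_succ_iff] using hk, hIk.symm⟩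
    obtain ⟨i, s, hs, h1, h2⟩ := this
    refine mul_eq_zero_of_right _ (prod_eq_zero h1 (prod_eq_zero (mem_compl.2 h2) ?_))
    refine div_eq_zero_iff.2 (Or.inl ?_)
    have := hx i
    simp only [hv_def]
    field_simp
    ring
  · intro k hk
    have hk : ∀ i, k i ≤ N i := by simpa [Nat.lt_succ_iff] using hk
    have hcompl : (univ.filter fun a : (Σ i, Fin (N i)) => (a.2 : ℕ) < k a.1)ᶜ =
        univ.filter fun a => k a.1 ≤ (a.2 : ℕ) := by
      ext a
      simp
    have hlow : ∀ i, (range (N i)).filter (· < k i) = range (k i) := by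
      intro i
      have := hk i
      ext s
      simp only [mem_filter, mem_range]
      lia
    have hhigh : ∀ i, (range (N i)).filter (k i ≤ ·) = Ico (k i) (N i) := by
      intro i
      ext s
      simp [and_comm]
    have hcard : #(univ.filter fun a : (Σ i, Fin (N i)) => (a.2 : ℕ) < k a.1) = ∑ i, k i := by
      rw [card_eq_sum_ones, sum_filter_val_lt N (fun i s => s < k i) fun _ _ => 1]
      simp [hlow]
    rw [hcard, hcompl, neg_pow z]
    simp only [hv_def, hpair]
    rw [prod_congr rfl fun (a : Σ i, Fin (N i)) _ => prod_filter_val_lt N (fun j t => k j ≤ t)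
      (fun j t => (1 - q ^ ((t : ℤ) - (a.2 : ℕ) + 1) * (x j / x a.1)) /
        (1 - q ^ ((t : ℤ) - (a.2 : ℕ)) * (x j / x a.1)))]
    rw [prod_filter_val_lt N (fun i s => s < k i) (fun i s =>
      ∏ j, ∏ t ∈ range (N j) with k j ≤ t, (1 - q ^ ((t : ℤ) - s + 1) * (x j / x i)) /
        (1 - q ^ ((t : ℤ) - s) * (x j / x i)))]
    simp only [hlow, hhigh]
    have hfac : ∀ i j : Fin n, _ := fun i j =>
      prod_prod_div_eq_qPoch q (x j / x i) hq (k := k i) (hk j)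
        (fun t => hgen j i _ (by lia))
        (fun s hs t ht => hgen j i _ (by rintro rfl; lia))
    rw [prod_congr rfl fun i _ => prod_comm]
    simp only [hfac]
    rw [prod_comm]
    simp only [mul_div_assoc]
    ring
end

section
/- Terminating A_n q-binomial theorem (rectangular sum, version 3): Let n be a positive integer, N_1, …, N_n nonnegative integers with |N| = N_1 + ⋯ + N_n, q a nonzero complex number that is not a root of unity, z a complex number, and x_1, …, x_n nonzero complex numbers such that x_i/x_j is not an integer power of q for i ≠ j. Then ∏_{i=1}^n (z·q^{|N|−N_i}/x_i; q)_{N_i} = ∑_{k_1=0}^{N_1} ⋯ ∑_{k_n=0}^{N_n} [ ∏_{i,j=1}^n (q·x_i/x_j; q)_{N_i} / [ (q·x_i/x_j; q)_{k_i} · (q^{1+k_i−k_j}·x_i/x_j; q)_{N_i−k_i} ] · (−1)^{|k|}·q^{|k|(|k|−1)/2 + ∑_{1≤i<j≤n} k_i·k_j}·z^{|k|} · ∏_{i=1}^n x_i^{−k_i} ], where |k| = k_1 + ⋯ + k_n. -/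
open Finset

theorem prod_sub_mul_div_sub_eq_pow_card_add {K ι : Type*} [Field K] [DecidableEq ι] (q : K)
    (w : ι → K) (S : Finset ι) (hw : Set.InjOn w S) (v : K) (hv : ∀ j ∈ S, v ≠ w j) :
    ∏ j ∈ S, (v - q * w j) / (v - w j) =
      q ^ #S + v * (1 - q) * ∑ j ∈ S, (∏ l ∈ S.erase j, (w j - q * w l) / (w j - w l)) /
        (v - w j) := by
  induction S using Finset.induction_on generalizing v with
  | empty => simp
  | insert a S ha ih =>
    have hw' : Set.InjOn w S := hw.mono (by simp)
    have hne : ∀ j ∈ S, w a ≠ w j := fun j hj h =>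
      ha (by rwa [hw (by simp) (by simp [hj]) h])
    have hva : v - w a ≠ 0 := sub_ne_zero.2 (hv a (by simp))
    rw [prod_insert ha, sum_insert ha, erase_insert ha, card_insert_of_notMem ha,
      ih hw' v fun j hj => hv j (by simp [hj]), ih hw' (w a) hne]
    have hstep : ∀ j ∈ S, (∏ l ∈ (insert a S).erase j, (w j - q * w l) / (w j - w l)) / (v - w j) =
        (v - q * w a) / (v - w a) *
          ((∏ l ∈ S.erase j, (w j - q * w l) / (w j - w l)) / (v - w j)) -
        w a * (1 - q) / (v - w a) *
          ((∏ l ∈ S.erase j, (w j - q * w l) / (w j - w l)) / (w a - w j)) := by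
      intro j hj
      have hja : j ≠ a := fun h => ha (h ▸ hj)
      rw [erase_insert_of_ne hja.symm, prod_insert (by simp [ha])]
      have h1 : v - w j ≠ 0 := sub_ne_zero.2 (hv j (by simp [hj]))
      have h2 : w a - w j ≠ 0 := sub_ne_zero.2 (hne j hj)
      have h3 : w j - w a ≠ 0 := sub_ne_zero.2 (hne j hj).symm
      generalize ∏ l ∈ S.erase j, (w j - q * w l) / (w j - w l) = P
      have h4 : w j - w a = -(w a - w j) := by ring
      rw [h4]
      field_simp
      ring
    rw [sum_congr rfl hstep, sum_sub_distrib, ← mul_sum, ← mul_sum]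
    generalize ∑ j ∈ S, (∏ l ∈ S.erase j, (w j - q * w l) / (w j - w l)) / (v - w j) = A
    generalize ∑ j ∈ S, (∏ l ∈ S.erase j, (w j - q * w l) / (w j - w l)) / (w a - w j) = B
    field_simp
    ring

theorem prod_sub_mul_div_sub_eq_pow_card_add' {K ι : Type*} [Field K] [DecidableEq ι] (q : K)
    (w : ι → K) (S : Finset ι) (hw : Set.InjOn w S) (v : K) (hv : ∀ j ∈ S, v ≠ w j) :
    ∏ j ∈ S, (w j - q * v) / (w j - v) =
      q ^ #S + (1 - q) * ∑ j ∈ S, w j * (∏ l ∈ S.erase j, (w l - q * w j) / (w l - w j)) /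
        (w j - v) := by
  induction S using Finset.induction_on generalizing v with
  | empty => simp
  | insert a S ha ih =>
    have hw' : Set.InjOn w S := hw.mono (by simp)
    have hne : ∀ j ∈ S, w a ≠ w j := fun j hj h =>
      ha (by rwa [hw (by simp) (by simp [hj]) h])
    have hva : w a - v ≠ 0 := sub_ne_zero.2 (hv a (by simp)).symm
    rw [prod_insert ha, sum_insert ha, erase_insert ha, card_insert_of_notMem ha,
      ih hw' v fun j hj => hv j (by simp [hj]), ih hw' (w a) hne]
    have hstep : ∀ j ∈ S,
        w j * (∏ l ∈ (insert a S).erase j, (w l - q * w j) / (w l - w j)) / (w j - v) =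
        (w a - q * v) / (w a - v) *
          (w j * (∏ l ∈ S.erase j, (w l - q * w j) / (w l - w j)) / (w j - v)) -
        w a * (1 - q) / (w a - v) *
          (w j * (∏ l ∈ S.erase j, (w l - q * w j) / (w l - w j)) / (w j - w a)) := by
      intro j hj
      have hja : j ≠ a := fun h => ha (h ▸ hj)
      rw [erase_insert_of_ne hja.symm, prod_insert (by simp [ha])]
      have h1 : w j - v ≠ 0 := sub_ne_zero.2 (hv j (by simp [hj])).symm
      have h2 : w a - w j ≠ 0 := sub_ne_zero.2 (hne j hj)
      generalize ∏ l ∈ S.erase j, (w l - q * w j) / (w l - w j) = P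
      have h4 : w j - w a = -(w a - w j) := by ring
      rw [h4]
      field_simp
      ring
    rw [sum_congr rfl hstep, sum_sub_distrib, ← mul_sum, ← mul_sum]
    generalize ∑ j ∈ S, w j * (∏ l ∈ S.erase j, (w l - q * w j) / (w l - w j)) / (w j - v) = A
    generalize ∑ j ∈ S, w j * (∏ l ∈ S.erase j, (w l - q * w j) / (w l - w j)) / (w j - w a) = B
    field_simp
    ring

theorem sum_powerset_sum_mem_eq {M ι : Type*} [AddCommMonoid M] [DecidableEq ι] (U : Finset ι)
    (F : Finset ι → ι → M) :
    ∑ S ∈ U.powerset, ∑ j ∈ S, F S j =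
      ∑ T ∈ U.powerset, ∑ j ∈ U \ T, F (insert j T) j := by
  rw [sum_sigma', sum_sigma']
  refine sum_bij' (fun p _ => ⟨p.1.erase p.2, p.2⟩) (fun p _ => ⟨insert p.2 p.1, p.2⟩) ?_ ?_ ?_ ?_ ?_
  · rintro ⟨S, j⟩ h
    simp only [mem_sigma, mem_powerset, mem_sdiff] at h ⊢
    exact ⟨(erase_subset _ _).trans h.1, h.1 h.2, by simp⟩
  · rintro ⟨S, j⟩ h
    simp only [mem_sigma, mem_powerset, mem_sdiff] at h ⊢
    exact ⟨insert_subset h.2.1 h.1, by simp⟩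
  · rintro ⟨S, j⟩ h
    simp only [mem_sigma] at h
    simp [insert_erase h.2]
  · rintro ⟨S, j⟩ h
    simp only [mem_sigma, mem_sdiff] at h
    simp [erase_insert h.2.2]
  · rintro ⟨S, j⟩ h
    simp only [mem_sigma] at h
    simp [insert_erase h.2]

/-- The summand indexed by `S ⊆ U` in the Hall-Littlewood type expansion of `∏ i ∈ U, (1 + z w i)`. -/
def subsetTerm {K ι : Type*} [Field K] [DecidableEq ι] (q : K) (w : ι → K) (U S : Finset ι) : K :=
  (∏ j ∈ S, w j) * ∏ i ∈ U \ S, ∏ j ∈ S, (w i - q * w j) / (w i - w j)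

theorem subsetTerm_insert_left {K ι : Type*} [Field K] [DecidableEq ι] (q : K) (w : ι → K)
    {U S : Finset ι} {a : ι} (ha : a ∉ U) (hS : S ⊆ U) :
    subsetTerm q w (insert a U) S =
      subsetTerm q w U S * ∏ j ∈ S, (w a - q * w j) / (w a - w j) := by
  have haS : a ∉ S := fun h => ha (hS h)
  rw [subsetTerm, subsetTerm, insert_sdiff_of_notMem _ haS, prod_insert (by simp [ha])]
  ring

theorem subsetTerm_insert_insert {K ι : Type*} [Field K] [DecidableEq ι] (q : K) (w : ι → K)
    {U S : Finset ι} {a : ι} (ha : a ∉ U) (hS : S ⊆ U) :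
    subsetTerm q w (insert a U) (insert a S) =
      subsetTerm q w U S * (w a * ∏ i ∈ U \ S, (w i - q * w a) / (w i - w a)) := by
  have haS : a ∉ S := fun h => ha (hS h)
  rw [subsetTerm, subsetTerm, insert_sdiff_insert, sdiff_insert_of_notMem ha, prod_insert haS,
    prod_congr rfl fun i _ => prod_insert haS, prod_mul_distrib]
  ring

theorem subsetTerm_insert_mul {K ι : Type*} [Field K] [DecidableEq ι] (q : K) (w : ι → K)
    {U T : Finset ι} {j : ι} (hjU : j ∈ U) (hjT : j ∉ T) (hT : T ⊆ U) :
    subsetTerm q w U (insert j T) * ∏ l ∈ T, (w j - q * w l) / (w j - w l) =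
      subsetTerm q w U T * (w j * ∏ l ∈ (U \ T).erase j, (w l - q * w j) / (w l - w j)) := by
  obtain ⟨V, hjV, rfl⟩ : ∃ V, j ∉ V ∧ insert j V = U := ⟨U.erase j, by simp, insert_erase hjU⟩
  have hTV : T ⊆ V := (subset_insert_iff_of_notMem hjT).1 hT
  rw [subsetTerm_insert_insert q w hjV hTV, subsetTerm_insert_left q w hjV hTV,
    insert_sdiff_of_notMem _ hjT, erase_insert (by simp [hjV])]
  ring

theorem sum_subsetTerm_eq_prod {K ι : Type*} [Field K] [DecidableEq ι] (q : K) (w : ι → K)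
    (U : Finset ι) (hw : Set.InjOn w U) (z : K) :
    ∑ S ∈ U.powerset, z ^ #S * q ^ (#S ^ 2) * subsetTerm q w U S =
      ∏ i ∈ U, (1 + z * q ^ #U * w i) := by
  induction U using Finset.induction_on generalizing z with
  | empty => simp [subsetTerm]
  | insert a U ha ih =>
    have hw' : Set.InjOn w U := hw.mono (by simp)
    have hne : ∀ j ∈ U, w a ≠ w j := fun j hj h =>
      ha (by rwa [hw (by simp) (by simp [hj]) h])
    have hprod : ∏ i ∈ U, (1 + z * q ^ (#U + 1) * w i) =
        ∏ i ∈ U, (1 + (q * z) * q ^ #U * w i) :=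
      prod_congr rfl fun i _ => by ring
    rw [sum_powerset_insert ha, prod_insert ha, card_insert_of_notMem ha, hprod, ← ih hw' (q * z),
      add_mul, one_mul, mul_sum]
    have hleft : ∀ S ∈ U.powerset,
        z ^ #S * q ^ (#S ^ 2) * subsetTerm q w (insert a U) S =
          (q * z) ^ #S * q ^ (#S ^ 2) * subsetTerm q w U S +
          ∑ j ∈ S, z ^ #S * q ^ (#S ^ 2) * w a * (1 - q) / (w a - w j) *
            (subsetTerm q w U S * ∏ l ∈ S.erase j, (w j - q * w l) / (w j - w l)) := by
      intro S hS
      rw [mem_powerset] at hS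
      rw [subsetTerm_insert_left q w ha hS, prod_sub_mul_div_sub_eq_pow_card_add q w S
        (hw'.mono (by exact_mod_cast hS)) (w a) fun j hj => hne j (hS hj), mul_pow, mul_add,
        mul_add, mul_sum, mul_sum, mul_sum]
      refine congr_arg₂ _ (by ring) (sum_congr rfl fun j _ => by ring)
    have hright : ∀ S ∈ U.powerset,
        z ^ #(insert a S) * q ^ (#(insert a S) ^ 2) * subsetTerm q w (insert a U) (insert a S) =
          z * q ^ (#U + 1) * w a * ((q * z) ^ #S * q ^ (#S ^ 2) * subsetTerm q w U S) +
          ∑ j ∈ U \ S, z ^ (#S + 1) * q ^ ((#S + 1) ^ 2) * w a * (1 - q) / (w j - w a) *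
            (subsetTerm q w U S *
              (w j * ∏ l ∈ (U \ S).erase j, (w l - q * w j) / (w l - w j))) := by
      intro S hS
      rw [mem_powerset] at hS
      obtain ⟨c, hc⟩ : ∃ c, #U = #S + c := ⟨#U - #S, by have := card_le_card hS; omega⟩
      have hc' : #(U \ S) = c := by rw [card_sdiff_of_subset hS]; omega
      rw [subsetTerm_insert_insert q w ha hS, prod_sub_mul_div_sub_eq_pow_card_add' q w (U \ S)
        (hw'.mono (by simp)) (w a) fun j hj => hne j (mem_sdiff.1 hj).1, mul_pow, mul_add,
        mul_add, mul_add, mul_sum, mul_sum, mul_sum, mul_sum, hc', hc,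
        card_insert_of_notMem fun h => ha (hS h)]
      refine congr_arg₂ _ (by ring) (sum_congr rfl fun j _ => by ring)
    rw [sum_congr rfl hleft, sum_congr rfl hright, sum_add_distrib, sum_add_distrib,
      sum_powerset_sum_mem_eq, add_add_add_comm, ← sum_add_distrib (s := U.powerset)
        (f := fun T => ∑ j ∈ U \ T, _)]
    refine (add_eq_left.2 (sum_eq_zero fun T hT => ?_))
    rw [mem_powerset] at hT
    rw [← sum_add_distrib]
    refine sum_eq_zero fun j hj => ?_
    rw [mem_sdiff] at hj
    rw [erase_insert hj.2, subsetTerm_insert_mul q w hj.1 hj.2 hT, card_insert_of_notMem hj.2,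
      ← neg_sub (w a) (w j), div_neg]
    ring

theorem qPoch_eq_mul (q a : ℂ) {k N : ℕ} (h : k ≤ N) :
    qPoch q a N = qPoch q a k * qPoch q (a * q ^ k) (N - k) := by
  obtain ⟨m, rfl⟩ := Nat.exists_eq_add_of_le h
  rw [qPoch, prod_range_add, Nat.add_sub_cancel_left, qPoch, qPoch]
  exact congr_arg _ (prod_congr rfl fun i _ => by ring)

theorem prod_range_div_succ_of_ne_zero {K : Type*} [Field K] (f : ℕ → K) (k : ℕ)
    (hf : ∀ b ≤ k, f b ≠ 0) : ∏ b ∈ range k, f b / f (b + 1) = f 0 / f k := by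
  induction k with
  | zero => simp [hf 0 le_rfl]
  | succ k ih =>
    rw [prod_range_succ, ih fun b hb => hf b (by omega), div_mul_div_cancel₀ (hf k (by omega))]

theorem inv_sub_mul_inv {q y y' : ℂ} (hq : q ≠ 0) (hy : y ≠ 0) (c : ℂ) (a b : ℕ) :
    (y * q ^ a)⁻¹ - c * (y' * q ^ b)⁻¹ =
      (y * q ^ a)⁻¹ * (1 - c * q ^ ((a : ℤ) - b) * y / y') := by
  rw [zpow_sub₀ hq, zpow_natCast, zpow_natCast]
  have ha : q ^ a ≠ 0 := pow_ne_zero _ hq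
  have hb : q ^ b ≠ 0 := pow_ne_zero _ hq
  by_cases hy' : y' = 0
  · simp [hy']
  field_simp

theorem prod_Ico_prod_range_eq_qPoch_div {q y y' : ℂ} (hq : q ≠ 0) (hy : y ≠ 0) {k k' N : ℕ}
    (hk : k ≤ N) (h : ∀ m : ℤ, k < m + k' → q ^ m * y / y' ≠ 1)
    (h' : ∀ m : ℤ, 0 < m → q ^ m * y / y' ≠ 1) :
    ∏ a ∈ Ico k N, ∏ b ∈ range k',
        ((y * q ^ a)⁻¹ - q * (y' * q ^ b)⁻¹) / ((y * q ^ a)⁻¹ - (y' * q ^ b)⁻¹) =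
      qPoch q (q * y / y') N /
        (qPoch q (q * y / y') k * qPoch q (q ^ (1 + (k : ℤ) - (k' : ℤ)) * y / y') (N - k)) := by
  have hne : qPoch q (q * y / y') k ≠ 0 := by
    refine prod_ne_zero_iff.2 fun a _ => sub_ne_zero.2 fun hh => h' (1 + a) (by omega) ?_
    rw [zpow_add₀ hq, zpow_one, zpow_natCast, hh]
    ring
  rw [qPoch_eq_mul q _ hk, mul_div_mul_left _ _ hne, qPoch, qPoch, ← prod_div_distrib,
    prod_Ico_eq_prod_range]
  refine prod_congr rfl fun a ha => ?_
  have hterm : ∀ b ∈ range k', ((y * q ^ (k + a))⁻¹ - q * (y' * q ^ b)⁻¹) /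
      ((y * q ^ (k + a))⁻¹ - (y' * q ^ b)⁻¹) =
      (1 - q ^ ((k + a + 1 : ℤ) - b) * y / y') /
        (1 - q ^ ((k + a + 1 : ℤ) - (b + 1 : ℕ)) * y / y') := by
    intro b _
    have h1 := inv_sub_mul_inv (y' := y') hq hy 1 (k + a) b
    rw [one_mul, one_mul] at h1
    rw [h1, inv_sub_mul_inv hq hy q, mul_div_mul_left _ _ (inv_ne_zero (mul_ne_zero hy
      (pow_ne_zero _ hq))), ← zpow_one_add₀ hq]
    push_cast
    ring_nf
  rw [prod_congr rfl hterm, prod_range_div_succ_of_ne_zero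
    (fun b : ℕ => 1 - q ^ ((k + a + 1 : ℤ) - b) * y / y') k' fun b hb =>
      sub_ne_zero.2 (h _ (by omega)).symm]
  have e1 : q ^ ((k + a + 1 : ℤ) - (0 : ℕ)) = q * q ^ k * q ^ a := by
    rw [← pow_succ', ← pow_add, ← zpow_natCast]
    congr 1
    push_cast
    ring
  have e2 : q ^ ((k + a + 1 : ℤ) - k') = q ^ (1 + (k : ℤ) - (k' : ℤ)) * q ^ a := by
    rw [← zpow_natCast q a, ← zpow_add₀ hq]
    congr 1
    ring
  rw [e1, e2]
  congr 1 <;> ring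

theorem prod_range_inv_mul_pow (q y : ℂ) (k : ℕ) :
    ∏ a ∈ range k, (y * q ^ a)⁻¹ = y ^ (-(k : ℤ)) * (q ^ k.choose 2)⁻¹ := by
  rw [prod_inv_distrib, prod_mul_distrib, prod_pow_eq_pow_sum, sum_range_id,
    Nat.choose_two_right, prod_const, card_range, zpow_neg, zpow_natCast, mul_inv]

theorem choose_two_sum_eq {n : ℕ} (k : Fin n → ℕ) :
    (∑ i, k i).choose 2 =
      ∑ i, (k i).choose 2 + ∑ i, ∑ j, if i < j then k i * k j else 0 := by
  induction n with
  | zero => simp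
  | succ n ih =>
    have hadd : ∀ a b : ℕ, (a + b).choose 2 = a.choose 2 + b.choose 2 + a * b := by
      intro a b
      qify
      simp only [Nat.cast_choose_two]
      push_cast
      ring
    simp [Fin.sum_univ_succ, hadd, ih, mul_sum]
    ring

theorem qPoch_mul_pow_div_eq_prod {q y : ℂ} (hq : q ≠ 0) (hy : y ≠ 0) (z : ℂ) {N M : ℕ}
    (h : N ≤ M) :
    qPoch q (z * q ^ (M - N) / y) N = ∏ a ∈ range N, (1 + -z / q * q ^ M * (y * q ^ a)⁻¹) := by
  rw [qPoch, ← prod_range_reflect]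
  refine prod_congr rfl fun a ha => ?_
  obtain ⟨c, rfl⟩ := Nat.exists_eq_add_of_le h
  obtain ⟨d, rfl⟩ := Nat.exists_eq_add_of_lt (mem_range.1 ha)
  rw [Nat.add_sub_cancel_left, show a + d + 1 - 1 - a = d by omega]
  field_simp
  ring

theorem neg_div_pow_mul_pow_sq_eq {n : ℕ} {q : ℂ} (hq : q ≠ 0) (z : ℂ) (k : Fin n → ℕ) :
    (-z / q) ^ (∑ i, k i) * q ^ ((∑ i, k i) ^ 2) * (q ^ ∑ i, (k i).choose 2)⁻¹ =
      (-1) ^ (∑ i, k i) *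
        q ^ (Nat.choose (∑ i, k i) 2 + ∑ i, ∑ j, if i < j then k i * k j else 0) *
        z ^ (∑ i, k i) := by
  have hc := choose_two_sum_eq k
  have hsq : (∑ i, k i) ^ 2 = (∑ i, k i).choose 2 + (∑ i, k i).choose 2 + ∑ i, k i := by
    generalize ∑ i, k i = s
    qify
    rw [Nat.cast_choose_two]
    ring
  generalize (∑ i, ∑ j, if i < j then k i * k j else 0) = e at *
  generalize ∑ i, (k i).choose 2 = t at *
  generalize ∑ i, k i = s at *
  rw [hsq]
  nth_rewrite 2 [hc]
  rw [div_pow, neg_pow]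
  simp only [pow_add]
  field_simp

/-- Summands vanish unless the index set is closed under lowering the second coordinate. -/
theorem exists_eq_sigma_range_of_subsetTerm_ne_zero {n : ℕ} {N : Fin n → ℕ} {q : ℂ} (hq : q ≠ 0)
    {x : Fin n → ℂ} (hx : ∀ i, x i ≠ 0) {S : Finset ((_ : Fin n) × ℕ)}
    (hS : S ⊆ univ.sigma fun i => range (N i))
    (hne : subsetTerm q (fun p => (x p.1 * q ^ p.2)⁻¹) (univ.sigma fun i => range (N i)) S ≠ 0) :
    ∃ k : Fin n → ℕ, (∀ i, k i ≤ N i) ∧ (univ.sigma fun i => range (k i)) = S := by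
  have hdown : ∀ i a, (⟨i, a + 1⟩ : (_ : Fin n) × ℕ) ∈ S → (⟨i, a⟩ : (_ : Fin n) × ℕ) ∈ S := by
    intro i a h
    by_contra h'
    have hU := hS h
    simp only [mem_sigma, mem_univ, mem_range, true_and] at hU
    have hmem : (⟨i, a⟩ : (_ : Fin n) × ℕ) ∈ (univ.sigma fun i => range (N i)) \ S := by
      refine mem_sdiff.2 ⟨?_, h'⟩
      simp only [mem_sigma, mem_univ, mem_range, true_and]
      omega
    refine hne (mul_eq_zero_of_right _ (prod_eq_zero hmem (prod_eq_zero h ?_)))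
    have := hx i
    rw [div_eq_zero_iff]
    left
    field_simp
    ring
  have hex : ∀ i, ∃ a, (⟨i, a⟩ : (_ : Fin n) × ℕ) ∉ S := fun i =>
    ⟨N i, fun h => by simpa using hS h⟩
  refine ⟨fun i => Nat.find (hex i), fun i => ?_, ?_⟩
  · exact Nat.find_min' _ fun h => by simpa using hS h
  · ext ⟨i, a⟩
    simp only [mem_sigma, mem_univ, mem_range, true_and, Nat.lt_find_iff, not_not]
    refine ⟨fun h => h a le_rfl, fun h m hm => ?_⟩
    exact Nat.decreasingInduction (motive := fun m _ => (⟨i, m⟩ : (_ : Fin n) × ℕ) ∈ S)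
      (fun m _ hm => hdown i m hm) h hm

theorem subsetTerm_sigma_range {n : ℕ} {N k : Fin n → ℕ} (hk : ∀ i, k i ≤ N i) {q : ℂ}
    (hq : q ≠ 0) {x : Fin n → ℂ} (hx : ∀ i, x i ≠ 0)
    (hxq : ∀ i j : Fin n, ∀ m : ℤ, (i = j → 0 < m) → q ^ m * x i / x j ≠ 1) :
    subsetTerm q (fun p : (_ : Fin n) × ℕ => (x p.1 * q ^ p.2)⁻¹)
        (univ.sigma fun i => range (N i)) (univ.sigma fun i => range (k i)) =
      (∏ i, x i ^ (-(k i : ℤ))) * (q ^ ∑ i, (k i).choose 2)⁻¹ *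
        ∏ i, ∏ j, qPoch q (q * x i / x j) (N i) /
          (qPoch q (q * x i / x j) (k i) *
            qPoch q (q ^ (1 + (k i : ℤ) - (k j : ℤ)) * x i / x j) (N i - k i)) := by
  have hdiff : (univ.sigma fun i => range (N i)) \ (univ.sigma fun i => range (k i)) =
      univ.sigma fun i => Ico (k i) (N i) := by
    ext ⟨i, a⟩
    simp [and_comm]
  rw [subsetTerm, hdiff, prod_sigma, prod_sigma]
  refine congr_arg₂ _ ?_ (prod_congr rfl fun i _ => ?_)
  · rw [prod_congr rfl fun i _ => prod_range_inv_mul_pow q (x i) (k i), prod_mul_distrib,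
      prod_inv_distrib, prod_pow_eq_pow_sum]
  · simp only [prod_sigma]
    rw [prod_comm]
    refine prod_congr rfl fun j _ => ?_
    exact prod_Ico_prod_range_eq_qPoch_div hq (hx i) (hk i)
      (fun m hm => hxq i j m fun h => by subst h; omega)
      fun m hm => hxq i j m fun _ => hm

/-- Terminating `A_n` q-binomial theorem (rectangular sum, version 3). -/
theorem stmt_9 (n : ℕ) (hn : 0 < n) (N : Fin n → ℕ) (q : ℂ) (hq : q ≠ 0)
    (hqru : ∀ m : ℕ, 0 < m → q ^ m ≠ 1) (z : ℂ)
    (x : Fin n → ℂ) (hx : ∀ i, x i ≠ 0)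
    (hxq : ∀ i j : Fin n, i ≠ j → ∀ m : ℤ, x i / x j ≠ q ^ m) :
    (∏ i, qPoch q (z * q ^ ((∑ j, N j) - N i) / x i) (N i)) =
      ∑ k ∈ Fintype.piFinset (fun i => Finset.range (N i + 1)),
        ((∏ i, ∏ j, qPoch q (q * x i / x j) (N i) /
            (qPoch q (q * x i / x j) (k i) *
              qPoch q (q ^ (1 + (k i : ℤ) - (k j : ℤ)) * x i / x j) (N i - k i))) *
          (-1) ^ (∑ i, k i) *
          q ^ (Nat.choose (∑ i, k i) 2 + ∑ i, ∑ j, if i < j then k i * k j else 0) *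
          z ^ (∑ i, k i) * ∏ i, x i ^ (-(k i : ℤ))) := by
  have hzpow : ∀ m : ℤ, 0 < m → q ^ m ≠ 1 := by
    intro m hm
    lift m to ℕ using hm.le
    rw [zpow_natCast]
    exact hqru m (by omega)
  have hratio : ∀ i j : Fin n, ∀ m : ℤ, (i = j → 0 < m) → q ^ m * x i / x j ≠ 1 := by
    intro i j m hm h
    by_cases hij : i = j
    · subst hij
      rw [mul_div_assoc, div_self (hx i), mul_one] at h
      exact hzpow m (hm rfl) h
    · refine hxq i j hij (-m) ?_
      rw [mul_div_assoc] at h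
      rw [zpow_neg]
      exact eq_inv_of_mul_eq_one_right h
  set w : (_ : Fin n) × ℕ → ℂ := fun p => (x p.1 * q ^ p.2)⁻¹ with hw_def
  set U : Finset ((_ : Fin n) × ℕ) := univ.sigma fun i => range (N i) with hU
  have hinj : Function.Injective w := by
    rintro ⟨i, a⟩ ⟨j, b⟩ h
    have h1 : x i * q ^ a = x j * q ^ b := inv_injective h
    have key : ∀ i j : Fin n, ∀ a b : ℕ, x i * q ^ a = x j * q ^ b →
        q ^ ((a : ℤ) - b) * x i / x j = 1 := by
      intro i j a b h
      have := hx j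
      have hb : q ^ b ≠ 0 := pow_ne_zero _ hq
      rw [zpow_sub₀ hq, zpow_natCast, zpow_natCast]
      field_simp
      linear_combination h
    have hij : i = j := by
      by_contra hij
      exact hratio i j _ (fun h => absurd h hij) (key i j a b h1)
    subst hij
    have hab : a = b := by
      rcases lt_trichotomy a b with hab | hab | hab
      · exact absurd (key i i b a h1.symm) (hratio i i _ fun _ => by omega)
      · exact hab
      · exact absurd (key i i a b h1) (hratio i i _ fun _ => by omega)
    rw [hab]
  have hcard : #U = ∑ j, N j := by simp [hU]
  have hmain := sum_subsetTerm_eq_prod q w U hinj.injOn (-z / q)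
  have hLHS : ∏ i ∈ U, (1 + -z / q * q ^ #U * w i) =
      ∏ i, qPoch q (z * q ^ ((∑ j, N j) - N i) / x i) (N i) := by
    rw [hU, prod_sigma, ← hU, hcard]
    refine prod_congr rfl fun i _ => ?_
    exact (qPoch_mul_pow_div_eq_prod hq (hx i) z
      (single_le_sum (fun j _ => Nat.zero_le (N j)) (mem_univ i))).symm
  rw [← hLHS, ← hmain]
  set box : (Fin n → ℕ) → Finset ((_ : Fin n) × ℕ) := fun k => univ.sigma fun i => range (k i)
    with hbox
  have hbox_inj : Function.Injective box := by
    intro k k' h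
    funext i
    have : ∀ a, a < k i ↔ a < k' i := fun a => by
      have := Finset.ext_iff.1 h ⟨i, a⟩
      simpa [hbox] using this
    exact le_antisymm (le_of_forall_lt fun a ha => (this a).1 ha)
      (le_of_forall_lt fun a ha => (this a).2 ha)
  have hsub : (Fintype.piFinset fun i => range (N i + 1)).image box ⊆ U.powerset := by
    intro S hS
    obtain ⟨k, hk, rfl⟩ := mem_image.1 hS
    rw [Fintype.mem_piFinset] at hk
    refine mem_powerset.2 (sigma_mono (subset_refl _) fun i => ?_)
    have := mem_range.1 (hk i)
    exact range_subset_range.2 (by omega)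
  rw [← sum_subset hsub, sum_image fun _ _ _ _ h => hbox_inj h]
  · refine sum_congr rfl fun k hk => ?_
    have hk : ∀ i, k i ≤ N i := fun i => by
      have := mem_range.1 (Fintype.mem_piFinset.1 hk i)
      omega
    have hkcard : #(box k) = ∑ i, k i := by simp [hbox]
    rw [hkcard, hU, hbox, hw_def, subsetTerm_sigma_range hk hq hx hratio]
    linear_combination (∏ i, x i ^ (-(k i : ℤ))) *
      (∏ i, ∏ j, qPoch q (q * x i / x j) (N i) / (qPoch q (q * x i / x j) (k i) *
        qPoch q (q ^ (1 + (k i : ℤ) - (k j : ℤ)) * x i / x j) (N i - k i))) *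
      neg_div_pow_mul_pow_sq_eq hq z k
  · intro S hS hS'
    rw [mem_powerset] at hS
    by_contra hne
    obtain ⟨k, hk, rfl⟩ := exists_eq_sigma_range_of_subsetTerm_ne_zero hq hx hS
      (right_ne_zero_of_mul hne)
    exact hS' (mem_image.2 ⟨k, Fintype.mem_piFinset.2 fun i =>
      mem_range.2 (Nat.lt_succ_of_le (hk i)), rfl⟩)
end
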